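/- Let K be a field of characteristic 0, let L ∈ K^{(d+1)×(n+1)} have rank d+1, and let 𝕃 ⊂ ℙ^n(K̄) be a linear subspace of dimension n−d defined over K which intersects the reciprocal linear space ℛ_L in finitely many points, i.e. deg ℛ_L many points counted with multiplicity (equivalently, K̄[ℛ_L]/I(𝕃) has Krull dimension 1). Then HReg(K[ℛ_L]/I(𝕃)) ≤ d, and the Hilbert function HF_{K[ℛ_L]/I(𝕃)}(q) = dim_K (K[ℛ_L]/I(𝕃))_q equals deg ℛ_L for all q ≥ d. -/

import Mathlib

open scoped BigOperators
noncomputable section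

namespace ScatteringPaper

open CategoryTheory AlgebraicTopology

/- ## Topological Euler characteristic via rational singular homology -/

/-- The singular chain complex of a topological space, with rational coefficients. -/
def singularChainComplex (X : Type) [TopologicalSpace X] : ChainComplex (ModuleCat ℚ) ℕ :=
  (alternatingFaceMapComplex (ModuleCat ℚ)).obj
    (((SimplicialObject.whiskering _ _).obj (ModuleCat.free ℚ)).obj (TopCat.toSSet.obj (TopCat.of X)))

/-- The `q`-th (rational) Betti number of a topological space. -/
def betti (X : Type) [TopologicalSpace X] (q : ℕ) : ℕ :=
  Module.finrank ℚ ((singularChainComplex X).homology q)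

/-- The topological Euler characteristic, as the alternating sum of Betti numbers. -/
def eulerChar (X : Type) [TopologicalSpace X] : ℤ :=
  ∑ᶠ q : ℕ, (-1 : ℤ) ^ q * (betti X q : ℤ)

variable {d : ℕ} {ι : Type} [Fintype ι] [DecidableEq ι]

/- ## Hyperplane arrangements: `(ℓ_i(x))_i = (1, x_1, …, x_d) · L` -/

/-- Value of the affine-linear form encoded by column `i` of `L`. -/
def ell (K : Type) [Field K] (L : Matrix (Fin (d+1)) ι K) (x : Fin d → K) (i : ι) : K :=
  L 0 i + ∑ j : Fin d, x j * L j.succ i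

/-- The complement `X = ℂ^d ∖ 𝒜` of the arrangement `𝒜 = V(∏ ℓ_i)`. -/
def complementX (L : Matrix (Fin (d+1)) ι ℂ) : Set (Fin d → ℂ) := {x | ∀ i, ell ℂ L x i ≠ 0}

/-- `x ∈ X` is a solution of the scattering equations
`∂ℒ_u/∂x_k = ∑_i u_i a_{ki}/ℓ_i(x) = 0`, `k = 1, …, d`. -/
def IsSol (L : Matrix (Fin (d+1)) ι ℂ) (u : ι → ℂ) (x : Fin d → ℂ) : Prop :=
  x ∈ complementX L ∧ ∀ k : Fin d, ∑ i : ι, u i * L k.succ i / ell ℂ L x i = 0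

/-- An arrangement is essential if some subset of its hyperplanes meets in a single point. -/
def IsEssential (L : Matrix (Fin (d+1)) ι ℂ) : Prop :=
  ∃ (S : Set ι) (x₀ : Fin d → ℂ), {x : Fin d → ℂ | ∀ i ∈ S, ell ℂ L x i = 0} = {x₀}

/-- `P u` holds for all `u` outside a proper algebraic subset (i.e. for generic `u`). -/
def Generically {σ : Type} [Fintype σ] [DecidableEq σ] (P : (σ → ℂ) → Prop) : Prop :=
  ∃ g : MvPolynomial σ ℂ, g ≠ 0 ∧ ∀ u : σ → ℂ, MvPolynomial.eval u g ≠ 0 → P u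

/- ## Matroid data of the columns of `L` -/

/-- Rank of the set `I` of columns of `L` (the matroid rank in `M(L)`). -/
def rkL (K : Type) [Field K] (L : Matrix (Fin (d+1)) ι K) (I : Set ι) : ℕ :=
  Module.finrank K (Submodule.span K ((fun i => fun r => L r i) '' I))

/-- Rank of the set `I` of columns of `A^⊤` (`L` with its first row deleted). -/
def rkA (K : Type) [Field K] (L : Matrix (Fin (d+1)) ι K) (I : Set ι) : ℕ :=
  Module.finrank K (Submodule.span K ((fun i => fun k : Fin d => L k.succ i) '' I))

/-- `I` is a flat of the matroid `M(L)`. -/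
def IsFlat (K : Type) [Field K] (L : Matrix (Fin (d+1)) ι K) (I : Set ι) : Prop :=
  ∀ i ∉ I, rkL K L I < rkL K L (insert i I)

/-- `C` is a circuit of `M(L)`: a minimal linearly dependent set of columns. -/
def IsCircuit (K : Type) [Field K] (L : Matrix (Fin (d+1)) ι K) (C : Finset ι) : Prop :=
  (¬ LinearIndependent K (fun i : {a // a ∈ C} => fun r => L r i.1)) ∧
  ∀ D : Finset ι, D ⊂ C → LinearIndependent K (fun i : {a // a ∈ D} => fun r => L r i.1)

/-- `M(L)` is connected: there is no separation into two nonempty parts with additive rank. -/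
def MatroidConnected (K : Type) [Field K] (L : Matrix (Fin (d+1)) ι K) : Prop :=
  ∀ S : Set ι, S.Nonempty → Sᶜ.Nonempty → rkL K L S + rkL K L Sᶜ ≠ rkL K L Set.univ

/- ## The reciprocal linear space -/

/-- Zariski closure of a subset of affine space `K^ι`. -/
def zarClosure (K : Type) [Field K] (S : Set (ι → K)) : Set (ι → K) :=
  {v | ∀ f : MvPolynomial ι K, (∀ w ∈ S, MvPolynomial.eval w f = 0) → MvPolynomial.eval v f = 0}

/-- The affine cone over the image of `φ : x ↦ (ℓ_0(x)⁻¹ : ⋯ : ℓ_n(x)⁻¹)`. -/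
def coneImage (L : Matrix (Fin (d+1)) ι ℂ) : Set (ι → ℂ) :=
  {v | ∃ (c : ℂ) (x : Fin d → ℂ), x ∈ complementX L ∧ v = fun i => c / ell ℂ L x i}

/-- The vanishing ideal of a subset of affine space. -/
def vanishingIdeal (K : Type) [Field K] (S : Set (ι → K)) : Ideal (MvPolynomial ι K) where
  carrier := {f | ∀ v ∈ S, MvPolynomial.eval v f = 0}
  add_mem' := by
    intro a b ha hb v hv
    simp [map_add, ha v hv, hb v hv]
  zero_mem' := by intro v hv; simp
  smul_mem' := by
    intro c f hf v hv
    simp [smul_eq_mul, map_mul, hf v hv]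

/-- Projective space `ℙ^n = ℙ(ℂ^ι)`. -/
abbrev Pn (ι : Type) [Fintype ι] := Projectivization ℂ (ι → ℂ)

/-- The reciprocal linear space `ℛ_L ⊂ ℙ^n`, the Zariski closure of `im φ`. -/
def RL (L : Matrix (Fin (d+1)) ι ℂ) : Set (Pn ι) :=
  {p | p.rep ∈ zarClosure ℂ (coneImage L)}

/-- The linear space `𝕃_u = {y : A^⊤ diag(u) y = 0} ⊂ ℙ^n`. -/
def LuSet (L : Matrix (Fin (d+1)) ι ℂ) (u : ι → ℂ) : Set (Pn ι) :=
  {p | ∀ k : Fin d, ∑ i : ι, L k.succ i * u i * p.rep i = 0}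

/-- The torus orbit `U_I = {y ∈ ℙ^n : y_i ≠ 0 ⇔ i ∈ I}`. -/
def Ustratum (I : Set ι) : Set (Pn ι) := {p : Pn ι | ∀ i : ι, p.rep i ≠ 0 ↔ i ∈ I}

/-- `p = φ(x)` for the map `φ : x ↦ (ℓ_0(x)⁻¹ : ⋯ : ℓ_n(x)⁻¹)`. -/
def PhiRel (L : Matrix (Fin (d+1)) ι ℂ) (x : Fin d → ℂ) (p : Pn ι) : Prop :=
  ∃ hv : (fun i => (ell ℂ L x i)⁻¹) ≠ 0, p = Projectivization.mk ℂ (fun i => (ell ℂ L x i)⁻¹) hv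

/-- The image of `φ` in `ℙ^n`. -/
def imPhi (L : Matrix (Fin (d+1)) ι ℂ) : Set (Pn ι) :=
  {p | ∃ x ∈ complementX L, PhiRel L x p}

/-- Complement of the subarrangement `𝒜_I`. -/
def subComplement (L : Matrix (Fin (d+1)) ι ℂ) (I : Set ι) : Set (Fin d → ℂ) :=
  {x | ∀ i ∈ I, ell ℂ L x i ≠ 0}

/-- The affine cone over the image of the reciprocal map of the subarrangement indexed by `I`,
embedded in the coordinate subspace `{y_i = 0, i ∉ I}`. -/
def coneImageSub (L : Matrix (Fin (d+1)) ι ℂ) (I : Set ι) : Set (ι → ℂ) :=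
  {v | ∃ (c : ℂ) (x : Fin d → ℂ), x ∈ subComplement L I ∧
      v = I.indicator (fun i => c / ell ℂ L x i)}

/-- The reciprocal linear space `ℛ_{L_I}` of the submatrix `L_I`, embedded in `ℙ^n`. -/
def RLsub (L : Matrix (Fin (d+1)) ι ℂ) (I : Set ι) : Set (Pn ι) :=
  {p | p.rep ∈ zarClosure ℂ (coneImageSub L I)}

/-- The open stratum `ℛ_{L_I}^∘ = ℛ_{L_I} ∩ U_I`. -/
def RLsubOpen (L : Matrix (Fin (d+1)) ι ℂ) (I : Set ι) : Set (Pn ι) :=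
  RLsub L I ∩ Ustratum I

/- ## The very affine variety `X_I = (ℂ^d ∖ 𝒜_I)/K_I` -/

/-- Quotient of `ℂ^d ∖ 𝒜_I` by translation by the left kernel `K_I` of `A_I^⊤`:
two points are identified iff `A_I^⊤` takes the same values on them. -/
def XIsetoid (L : Matrix (Fin (d+1)) ι ℂ) (I : Set ι) : Setoid ↥(subComplement L I) where
  r x y := ∀ i ∈ I, ∑ k : Fin d, (x : Fin d → ℂ) k * L k.succ i
      = ∑ k : Fin d, (y : Fin d → ℂ) k * L k.succ i
  iseqv := ⟨fun _ _ _ => rfl, fun h i hi => (h i hi).symm, fun h1 h2 i hi => (h1 i hi).trans (h2 i hi)⟩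

/-- The very affine variety `X_I = (ℂ^d ∖ 𝒜_I)/K_I`. -/
def XI (L : Matrix (Fin (d+1)) ι ℂ) (I : Set ι) : Type := Quotient (XIsetoid L I)

instance (L : Matrix (Fin (d+1)) ι ℂ) (I : Set ι) : TopologicalSpace (XI L I) :=
  instTopologicalSpaceQuotient

/-- The complement of the arrangement, over a general field `K`. -/
def complementK (K : Type) [Field K] (L : Matrix (Fin (d+1)) ι K) : Set (Fin d → K) :=
  {x | ∀ i, ell K L x i ≠ 0}

/-- The affine cone over the image of the reciprocal map, over a general field `K`. -/
def coneImageK (K : Type) [Field K] (L : Matrix (Fin (d+1)) ι K) : Set (ι → K) :=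
  {v | ∃ (c : K) (x : Fin d → K), x ∈ complementK K L ∧ v = fun i => c / ell K L x i}

/- ## Hilbert functions, degree, Hilbert regularity -/

/-- The Hilbert function of the graded algebra `K[y]/I`:
`q ↦ dim_K (K[y]/I)_q`. -/
def hilb (K : Type) [Field K] (I : Ideal (MvPolynomial ι K)) (q : ℕ) : ℕ :=
  Module.finrank K ((MvPolynomial.homogeneousSubmodule ι K q).map
    (Ideal.Quotient.mkₐ K I).toLinearMap)

/-- `k` is the degree of the `d`-dimensional projective variety with homogeneous
coordinate ring `K[y]/I`: the Hilbert polynomial has degree `d` and leading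
coefficient `k/d!`. -/
def IsProjDegree (K : Type) [Field K] (I : Ideal (MvPolynomial ι K)) (d k : ℕ) : Prop :=
  ∃ P : Polynomial ℚ, (∃ N : ℕ, ∀ q : ℕ, N ≤ q → Polynomial.eval (q : ℚ) P = hilb K I q) ∧
    P.degree = (d : WithBot ℕ) ∧ P.leadingCoeff = (k : ℚ) / (Nat.factorial d : ℚ)

/-- The Hilbert function, extended by `0` to negative integers. -/
def HFZ (K : Type) [Field K] (I : Ideal (MvPolynomial ι K)) (q : ℤ) : ℕ :=
  if 0 ≤ q then hilb K I q.toNat else 0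

/-- The Hilbert regularity: the smallest degree from which the Hilbert function
agrees with a (necessarily unique) polynomial. -/
def HReg (K : Type) [Field K] (I : Ideal (MvPolynomial ι K)) : ℤ :=
  sInf {i : ℤ | ∃ P : Polynomial ℚ, ∀ q : ℤ, i ≤ q → Polynomial.eval (q : ℚ) P = HFZ K I q}

set_option linter.unusedSectionVars false

/-! ### Depth via Ext -/

section Depth

open Abelian

/-- Depth of `M` with respect to `m` is at least `k`. -/
def Dep {R : Type} [CommRing R] (m : Ideal R) (k : ℕ) (M : Type) [AddCommGroup M] [Module R M] :
    Prop :=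
  ∀ i < k, Subsingleton (Ext (ModuleCat.of R (R ⧸ m)) (ModuleCat.of R M) i)

variable {R : Type} [CommRing R] {m : Ideal R}
variable {M₁ M₂ M₃ : Type} [AddCommGroup M₁] [Module R M₁] [AddCommGroup M₂] [Module R M₂]
  [AddCommGroup M₃] [Module R M₃]

lemma Dep.mono {k l : ℕ} (h : Dep m l M₁) (hkl : k ≤ l) : Dep m k M₁ :=
  fun i hi => h i (by omega)

lemma Dep.of_subsingleton (k : ℕ) [Subsingleton M₁] : Dep m k M₁ := by
  intro i _
  have h0 : Limits.IsZero (ModuleCat.of R M₁) := ModuleCat.isZero_of_subsingleton _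
  refine ⟨fun a b => ?_⟩
  rw [← a.comp_mk₀_id, ← b.comp_mk₀_id, h0.eq_of_src (𝟙 _) 0]
  simp

lemma Dep.of_equiv {k : ℕ} (h : Dep m k M₁) (e : M₁ ≃ₗ[R] M₂) : Dep m k M₂ := by
  intro i hi
  have := h i hi
  refine ⟨fun a b => ?_⟩
  have key : ∀ a : Ext (ModuleCat.of R (R ⧸ m)) (ModuleCat.of R M₂) i,
      a = (a.comp (Ext.mk₀ e.toModuleIso.inv) (add_zero i)).comp
        (Ext.mk₀ e.toModuleIso.hom) (add_zero i) := by
    intro a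
    rw [Ext.comp_assoc_of_second_deg_zero, Ext.mk₀_comp_mk₀, Iso.inv_hom_id, Ext.comp_mk₀_id]
  rw [key a, key b, Subsingleton.elim (a.comp (Ext.mk₀ e.toModuleIso.inv) (add_zero i))
    (b.comp (Ext.mk₀ e.toModuleIso.inv) (add_zero i))]

lemma shortExact_of {f : M₁ →ₗ[R] M₂} {g : M₂ →ₗ[R] M₃} (hf : Function.Injective f)
    (hfg : Function.Exact f g) (hg : Function.Surjective g) :
    (ModuleCat.shortComplexOfCompEqZero f g hfg.linearMap_comp_eq_zero).ShortExact where
  exact := ModuleCat.shortComplex_exact _ hfg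
  mono_f := by simpa [ModuleCat.shortComplexOfCompEqZero, ModuleCat.mono_iff_injective] using hf
  epi_g := by simpa [ModuleCat.shortComplexOfCompEqZero, ModuleCat.epi_iff_surjective] using hg

lemma Dep.left {k : ℕ} {f : M₁ →ₗ[R] M₂} {g : M₂ →ₗ[R] M₃} (hf : Function.Injective f)
    (hfg : Function.Exact f g) (hg : Function.Surjective g)
    (h2 : Dep m (k + 1) M₂) (h3 : Dep m k M₃) : Dep m (k + 1) M₁ := by
  have hS := shortExact_of hf hfg hg
  intro i hi
  refine subsingleton_of_forall_eq 0 fun x => ?_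
  have s2 := h2 i hi
  cases i with
  | zero =>
    apply Ext.postcomp_mk₀_injective_of_mono (ModuleCat.of R (R ⧸ m)) (ModuleCat.ofHom f)
      (hf := by simpa [ModuleCat.mono_iff_injective] using hf)
    exact s2.elim _ _
  | succ j =>
    obtain ⟨x₃, rfl⟩ := Ext.covariant_sequence_exact₁ (ModuleCat.of R (R ⧸ m)) hS x
      (s2.elim _ _) rfl
    have := (h3 j (by omega)).elim x₃ 0
    rw [this]; simp

lemma Dep.right {k : ℕ} {f : M₁ →ₗ[R] M₂} {g : M₂ →ₗ[R] M₃} (hf : Function.Injective f)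
    (hfg : Function.Exact f g) (hg : Function.Surjective g)
    (h2 : Dep m k M₂) (h1 : Dep m (k + 1) M₁) : Dep m k M₃ := by
  have hS := shortExact_of hf hfg hg
  intro i hi
  refine subsingleton_of_forall_eq 0 fun x => ?_
  obtain ⟨x₂, rfl⟩ := Ext.covariant_sequence_exact₃ (ModuleCat.of R (R ⧸ m)) hS x rfl
      ((h1 (i+1) (by omega)).elim _ _)
  have := (h2 i (by omega)).elim x₂ 0
  rw [this]; simp

lemma Dep.of_smul {k : ℕ} {r : R} (hr : r ∈ m) {g : M₂ →ₗ[R] M₃}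
    (hf : Function.Injective (LinearMap.lsmul R M₂ r))
    (hfg : Function.Exact (LinearMap.lsmul R M₂ r) g) (hg : Function.Surjective g)
    (h3 : Dep m k M₃) : Dep m (k + 1) M₂ := by
  have hS := shortExact_of hf hfg hg
  intro i hi
  have zero : ∀ x : Ext (ModuleCat.of R (R ⧸ m)) (ModuleCat.of R M₂) i,
      x.comp (Ext.mk₀ (ModuleCat.ofHom (LinearMap.lsmul R M₂ r))) (add_zero i) = 0 := by
    intro x
    have e1 : ModuleCat.ofHom (LinearMap.lsmul R M₂ r) = r • 𝟙 (ModuleCat.of R M₂) := rfl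
    have e2 : r • 𝟙 (ModuleCat.of R (R ⧸ m)) = 0 := by
      ext
      change r • (Submodule.Quotient.mk 1 : R ⧸ m) = 0
      rw [← Submodule.Quotient.mk_smul, Submodule.Quotient.mk_eq_zero]
      simpa using hr
    rw [e1, ← Ext.smul_eq_comp_mk₀, ← x.mk₀_id_comp, ← Ext.smul_comp, ← Ext.mk₀_smul, e2]
    simp
  refine subsingleton_of_forall_eq 0 fun x => ?_
  cases i with
  | zero =>
    apply Ext.postcomp_mk₀_injective_of_mono (ModuleCat.of R (R ⧸ m))
      (ModuleCat.ofHom (LinearMap.lsmul R M₂ r))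
      (hf := by simpa [ModuleCat.mono_iff_injective] using hf)
    simpa using zero x
  | succ j =>
    obtain ⟨x₃, rfl⟩ := Ext.covariant_sequence_exact₁ (ModuleCat.of R (R ⧸ m)) hS x
      (zero x) rfl
    have := (h3 j (by omega)).elim x₃ 0
    rw [this]; simp

lemma Dep.quot_smul {k : ℕ} {r : R} {g : M₂ →ₗ[R] M₃}
    (hf : Function.Injective (LinearMap.lsmul R M₂ r))
    (hfg : Function.Exact (LinearMap.lsmul R M₂ r) g) (hg : Function.Surjective g)
    (h2 : Dep m (k + 1) M₂) : Dep m k M₃ :=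
  Dep.right hf hfg hg (h2.mono (by omega)) h2

lemma Dep.eq_zero {k : ℕ} (h : Dep m (k + 1) M₁) {x : M₁} (hx : ∀ r ∈ m, r • x = 0) : x = 0 := by
  have s0 := h 0 (by omega)
  have : Subsingleton (ModuleCat.of R (R ⧸ m) ⟶ ModuleCat.of R M₁) :=
    Ext.addEquiv₀.subsingleton_congr.mp s0
  have : Subsingleton ((R ⧸ m) →ₗ[R] M₁) := 
    (ModuleCat.homAddEquiv (M := ModuleCat.of R (R ⧸ m))
      (N := ModuleCat.of R M₁)).symm.subsingleton
  let φ : (R ⧸ m) →ₗ[R] M₁ := Submodule.liftQ m (LinearMap.toSpanSingleton R M₁ x)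
    (fun r hr => by simpa using hx r hr)
  have h1 : φ (Submodule.Quotient.mk 1) = x := by
    change LinearMap.toSpanSingleton R M₁ x 1 = x
    simp
  rw [← h1, this.elim φ 0]; simp

lemma Dep.eq_zero_pow {k : ℕ} (h : Dep m (k + 1) M₁) (s : ℕ) {x : M₁}
    (hx : ∀ r ∈ m ^ s, r • x = 0) : x = 0 := by
  induction s generalizing x with
  | zero => simpa using hx 1 (by simp)
  | succ s ih =>
    refine h.eq_zero fun r hr => ih fun t ht => ?_
    rw [smul_smul]
    exact hx _ (by rw [pow_succ]; exact Ideal.mul_mem_mul ht hr)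

end Depth



/-! ### Reciprocal linear spaces of restricted arrangements: generators of the ideal -/

section Recip

open MvPolynomial

variable {K : Type} [Field K] {W : Type} [AddCommGroup W] [Module K W]

/-- Reciprocal coordinates. -/
def yv (v : ι → W →ₗ[K] K) (E : Finset ι) (x : W) : ι → K :=
  fun i => if i ∈ E then (v i x)⁻¹ else 0

/-- Complement of the arrangement restricted to `X`. -/
def UU (v : ι → W →ₗ[K] K) (E : Finset ι) (X : Submodule K W) : Set W :=
  {x | x ∈ X ∧ ∀ i ∈ E, v i x ≠ 0}

/-- Vanishing ideal of the reciprocal points. -/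
def II (v : ι → W →ₗ[K] K) (E : Finset ι) (X : Submodule K W) : Ideal (MvPolynomial ι K) :=
  vanishingIdeal K (yv v E '' UU v E X)

lemma mem_II {v : ι → W →ₗ[K] K} {E : Finset ι} {X : Submodule K W} {f : MvPolynomial ι K} :
    f ∈ II v E X ↔ ∀ x ∈ UU v E X, eval (yv v E x) f = 0 := by
  change (∀ w ∈ yv v E '' UU v E X, eval w f = 0) ↔ _
  simp

/-- The polynomial attached to a linear dependency. -/
def relp (T : Finset ι) (c : ι → K) : MvPolynomial ι K :=
  ∑ i ∈ T, C (c i) * ∏ j ∈ T.erase i, MvPolynomial.X j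

/-- The ideal generated by all linear dependencies. -/
def Circ (v : ι → W →ₗ[K] K) (E : Finset ι) (X : Submodule K W) : Ideal (MvPolynomial ι K) :=
  Ideal.span ({f | ∃ i, i ∉ E ∧ f = MvPolynomial.X i} ∪
    {f | ∃ (T : Finset ι) (c : ι → K), T ⊆ E ∧ (∀ x ∈ X, ∑ i ∈ T, c i * v i x = 0) ∧
      f = relp T c})

lemma X_mem_Circ {v : ι → W →ₗ[K] K} {E : Finset ι} {X : Submodule K W} {i : ι} (hi : i ∉ E) :
    MvPolynomial.X i ∈ Circ v E X :=
  Ideal.subset_span (Or.inl ⟨i, hi, rfl⟩)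

lemma relp_mem_Circ {v : ι → W →ₗ[K] K} {E : Finset ι} {X : Submodule K W}
    {T : Finset ι} {c : ι → K} (hT : T ⊆ E) (hc : ∀ x ∈ X, ∑ i ∈ T, c i * v i x = 0) :
    relp T c ∈ Circ v E X :=
  Ideal.subset_span (Or.inr ⟨T, c, hT, hc, rfl⟩)

lemma Circ_le_II (v : ι → W →ₗ[K] K) (E : Finset ι) (X : Submodule K W) :
    Circ v E X ≤ II v E X := by
  refine Ideal.span_le.2 ?_
  rintro f (⟨i, hi, rfl⟩ | ⟨T, c, hT, hc, rfl⟩)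
  · refine mem_II.2 fun x hx => ?_
    simp [yv, hi]
  · refine mem_II.2 fun x hx => ?_
    have h := hc x hx.1
    have e1 : eval (yv v E x) (relp T c)
        = (∑ i ∈ T, c i * v i x) * ∏ j ∈ T, (v j x)⁻¹ := by
      rw [relp, map_sum, Finset.sum_mul]
      refine Finset.sum_congr rfl fun i hi => ?_
      rw [map_mul, eval_C, map_prod, ← Finset.mul_prod_erase T _ hi]
      have : ∏ j ∈ T.erase i, eval (yv v E x) (MvPolynomial.X j)
          = ∏ j ∈ T.erase i, (v j x)⁻¹ := by
        refine Finset.prod_congr rfl fun j hj => ?_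
        simp [yv, hT (Finset.mem_of_mem_erase hj)]
      rw [this]
      have hne := hx.2 i (hT hi)
      field_simp
    rw [e1, h, zero_mul]

/-- Rational functions on a line with denominators powers of `D`. -/
def IsRat (D : Polynomial K) (g : K → K) : Prop :=
  ∃ (m : ℕ) (N : Polynomial K), ∀ t, D.eval t ≠ 0 → N.eval t = D.eval t ^ m * g t

lemma IsRat.poly (D p : Polynomial K) : IsRat D (fun t => p.eval t) :=
  ⟨0, p, by simp⟩

lemma IsRat.add {D : Polynomial K} {g h : K → K} (hg : IsRat D g) (hh : IsRat D h) :
    IsRat D (fun t => g t + h t) := by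
  obtain ⟨m, N, h1⟩ := hg
  obtain ⟨n, N', h2⟩ := hh
  refine ⟨m + n, N * D ^ n + N' * D ^ m, fun t ht => ?_⟩
  simp only [Polynomial.eval_add, Polynomial.eval_mul, Polynomial.eval_pow, h1 t ht, h2 t ht]
  ring

lemma IsRat.mul {D : Polynomial K} {g h : K → K} (hg : IsRat D g) (hh : IsRat D h) :
    IsRat D (fun t => g t * h t) := by
  obtain ⟨m, N, h1⟩ := hg
  obtain ⟨n, N', h2⟩ := hh
  refine ⟨m + n, N * N', fun t ht => ?_⟩
  simp only [Polynomial.eval_mul, h1 t ht, h2 t ht]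
  ring

lemma IsRat.sum {D : Polynomial K} {α : Type} (s : Finset α) {g : α → K → K}
    (hg : ∀ i ∈ s, IsRat D (g i)) : IsRat D (fun t => ∑ i ∈ s, g i t) := by
  classical
  induction s using Finset.induction_on with
  | empty => simpa using IsRat.poly D 0
  | insert a s ha ih =>
    simp only [Finset.sum_insert ha]
    exact (hg a (by simp)).add (ih fun i hi => hg i (by simp [hi]))

lemma IsRat.zero [Infinite K] {D : Polynomial K} {g : K → K} (hg : IsRat D g)
    (hD : D.eval 0 ≠ 0) {p : Polynomial K} (hp : p ≠ 0)
    (h : ∀ t, D.eval t ≠ 0 → p.eval t ≠ 0 → g t = 0) : g 0 = 0 := by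
  obtain ⟨m, N, hN⟩ := hg
  have hD0 : D ≠ 0 := by rintro rfl; simp at hD
  have : N * p * D = 0 := by
    refine Polynomial.funext fun t => ?_
    by_cases h1 : D.eval t = 0
    · simp [h1]
    by_cases h2 : p.eval t = 0
    · simp [h2]
    simp [hN t h1, h t h1 h2]
  have hN0 : N = 0 := by simpa [hp, hD0] using this
  have h0 := hN 0 hD
  rw [hN0] at h0
  simpa [hD] using h0.symm

/-- Product of the forms along a line. -/
def lineD (v : ι → W →ₗ[K] K) (E : Finset ι) (x u : W) : Polynomial K :=
  ∏ i ∈ E, (Polynomial.C (v i x) + Polynomial.X * Polynomial.C (v i u))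

lemma lineD_eval (v : ι → W →ₗ[K] K) (E : Finset ι) (x u : W) (t : K) :
    (lineD v E x u).eval t = ∏ i ∈ E, v i (x + t • u) := by
  rw [lineD, Polynomial.eval_prod]
  refine Finset.prod_congr rfl fun i _ => ?_
  simp only [Polynomial.eval_add, Polynomial.eval_mul, Polynomial.eval_C, Polynomial.eval_X, map_add, map_smul, smul_eq_mul]

lemma lineD_ne {v : ι → W →ₗ[K] K} {E : Finset ι} {x u : W} {t : K} :
    (lineD v E x u).eval t ≠ 0 ↔ ∀ i ∈ E, v i (x + t • u) ≠ 0 := by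
  rw [lineD_eval, Finset.prod_ne_zero_iff]

lemma isRat_eval (v : ι → W →ₗ[K] K) (E : Finset ι) (x u : W) (f : MvPolynomial ι K) :
    IsRat (lineD v E x u) (fun t => eval (yv v E (x + t • u)) f) := by
  induction f using MvPolynomial.induction_on with
  | C a => simpa using IsRat.poly (lineD v E x u) (Polynomial.C a)
  | add p q hp hq => simpa using hp.add hq
  | mul_X p i hp =>
    simp only [map_mul, eval_X]
    refine hp.mul ?_
    by_cases hi : i ∈ E
    · refine ⟨1, lineD v (E.erase i) x u, fun t ht => ?_⟩
      have hne := lineD_ne.1 ht i hi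
      rw [pow_one, lineD_eval, lineD_eval, ← Finset.mul_prod_erase E _ hi]
      simp only [yv, hi, if_true]
      field_simp
    · simpa [yv, hi] using IsRat.poly (lineD v E x u) 0

/-- Setting the variable `e` to zero. -/
def pe (e : ι) : MvPolynomial ι K →ₐ[K] MvPolynomial ι K :=
  aeval (Function.update MvPolynomial.X e 0)

@[simp] lemma pe_X_self (e : ι) : pe (K := K) e (MvPolynomial.X e) = 0 := by simp [pe]

lemma pe_X_ne {e i : ι} (h : i ≠ e) : pe (K := K) e (MvPolynomial.X i) = MvPolynomial.X i := by
  simp [pe, h]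

lemma eval_pe {v : ι → W →ₗ[K] K} {E : Finset ι} {e : ι} (he : e ∉ E) (x : W)
    (f : MvPolynomial ι K) :
    eval (yv v (insert e E) x) (pe e f) = eval (yv v E x) f := by
  induction f using MvPolynomial.induction_on with
  | C a => simp [pe]
  | add p q hp hq => simp [hp, hq]
  | mul_X p i hp =>
    rw [map_mul, map_mul, hp, map_mul]
    congr 1
    by_cases h : i = e
    · subst h; simp [yv, he]
    · rw [pe_X_ne h]; simp [yv, h]

lemma sub_pe_mem (e : ι) (f : MvPolynomial ι K) :
    f - pe e f ∈ Ideal.span {(MvPolynomial.X e : MvPolynomial ι K)} := by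
  induction f using MvPolynomial.induction_on with
  | C a => simp [pe]
  | add p q hp hq =>
    have := Ideal.add_mem _ hp hq
    rw [map_add]; convert this using 1; ring
  | mul_X p i hp =>
    rw [map_mul]
    by_cases h : i = e
    · subst h
      rw [pe_X_self, mul_zero, sub_zero]
      exact Ideal.mul_mem_left _ _ (Ideal.subset_span rfl)
    · rw [pe_X_ne h, ← sub_mul]
      exact Ideal.mul_mem_right _ _ hp

lemma exists_rep (e : ι) (f : MvPolynomial ι K) : ∃ (N : ℕ) (c : ℕ → MvPolynomial ι K),
    f = ∑ k ∈ Finset.range (N + 1), MvPolynomial.X e ^ k * pe e (c k) := by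
  have extend : ∀ (N M : ℕ) (c : ℕ → MvPolynomial ι K), N ≤ M → ∃ c' : ℕ → MvPolynomial ι K,
      ∑ k ∈ Finset.range (N + 1), MvPolynomial.X e ^ k * pe e (c k)
      = ∑ k ∈ Finset.range (M + 1), MvPolynomial.X e ^ k * pe e (c' k) := by
    intro N M c h
    refine ⟨fun k => if k < N + 1 then c k else 0, ?_⟩
    rw [← Finset.sum_subset (Finset.range_mono (show N + 1 ≤ M + 1 by omega))]
    · refine Finset.sum_congr rfl fun k hk => ?_
      simp [Finset.mem_range.1 hk]
    · intro k _ hk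
      have hk' : ¬ k < N + 1 := by simpa using hk
      dsimp only
      rw [if_neg hk', map_zero, mul_zero]
  induction f using MvPolynomial.induction_on with
  | C a => exact ⟨0, fun _ => C a, by simp [pe]⟩
  | add p q hp hq =>
    obtain ⟨N, c, rfl⟩ := hp
    obtain ⟨M, c', rfl⟩ := hq
    obtain ⟨a, ha⟩ := extend N (N + M) c (by omega)
    obtain ⟨b, hb⟩ := extend M (N + M) c' (by omega)
    refine ⟨N + M, fun k => a k + b k, ?_⟩
    rw [ha, hb, ← Finset.sum_add_distrib]
    refine Finset.sum_congr rfl fun k _ => ?_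
    rw [map_add]; ring
  | mul_X p i hp =>
    obtain ⟨N, c, rfl⟩ := hp
    by_cases h : i = e
    · subst h
      refine ⟨N + 1, fun k => Nat.casesOn k 0 c, ?_⟩
      rw [Finset.sum_range_succ' _ (N + 1)]
      have h0 : MvPolynomial.X i ^ 0 * pe i (0 : MvPolynomial ι K) = 0 := by
        rw [map_zero, mul_zero]
      refine Eq.trans ?_ (congrArg (fun z => _ + z) h0.symm)
      rw [add_zero, Finset.sum_mul]
      refine Finset.sum_congr rfl fun k _ => ?_
      ring
    · refine ⟨N, fun k => c k * MvPolynomial.X i, ?_⟩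
      rw [Finset.sum_mul]
      refine Finset.sum_congr rfl fun k _ => ?_
      rw [map_mul, pe_X_ne h]; ring

lemma pe_relp {e : ι} {T : Finset ι} (he : e ∉ T) (c : ι → K) : pe e (relp T c) = relp T c := by
  rw [relp, map_sum]
  refine Finset.sum_congr rfl fun i _ => ?_
  rw [map_mul, map_prod]
  congr 1
  · simp [pe]
  · refine Finset.prod_congr rfl fun j hj => pe_X_ne ?_
    rintro rfl
    exact he (Finset.mem_of_mem_erase hj)

lemma pe_mem_Circ {v : ι → W →ₗ[K] K} {E : Finset ι} {X : Submodule K W} {e : ι} (he : e ∉ E)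
    {f : MvPolynomial ι K} (hf : f ∈ Circ v E X) : pe e f ∈ Circ v (insert e E) X := by
  refine Submodule.span_induction ?_ (by simp) ?_ ?_ hf
  · rintro f (⟨i, hi, rfl⟩ | ⟨T, c, hT, hc, rfl⟩)
    · by_cases h : i = e
      · subst h; simp
      · rw [pe_X_ne h]; exact X_mem_Circ (by simp [h, hi])
    · rw [pe_relp (fun h => he (hT h))]
      exact relp_mem_Circ (hT.trans (Finset.subset_insert _ _)) hc
  · intro a b _ _ ha hb
    rw [map_add]; exact Ideal.add_mem _ ha hb
  · intro a b _ hb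
    rw [smul_eq_mul, map_mul]; exact Ideal.mul_mem_left _ _ hb

/-- Multiplying an element vanishing on the hyperplane by `y_e`. -/
lemma core {v : ι → W →ₗ[K] K} {E : Finset ι} {X : Submodule K W} {e : ι} (he : e ∉ E)
    {u : W} (hu : u ∈ X) (hu1 : v e u = 1)
    {f : MvPolynomial ι K} (hf : f ∈ Circ v E (X ⊓ LinearMap.ker (v e))) :
    ∃ g, MvPolynomial.X e * pe e f - pe e g ∈ Circ v (insert e E) X := by
  refine Submodule.span_induction ?_ ⟨0, by simp⟩ ?_ ?_ hf
  · rintro f (⟨i, hi, rfl⟩ | ⟨T, c, hT, hc, rfl⟩)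
    · refine ⟨0, ?_⟩
      rw [map_zero, sub_zero]
      by_cases h : i = e
      · subst h; simp
      · rw [pe_X_ne h]
        exact Ideal.mul_mem_left _ _ (X_mem_Circ (by simp [h, hi]))
    · have heT : e ∉ T := fun h => he (hT h)
      set s : K := ∑ i ∈ T, c i * v i u with hs
      refine ⟨C s * ∏ j ∈ T, MvPolynomial.X j, ?_⟩
      have hr : relp (insert e T) (Function.update c e (-s)) ∈ Circ v (insert e E) X := by
        refine relp_mem_Circ (Finset.insert_subset_insert _ hT) fun x hx => ?_
        rw [Finset.sum_insert heT, Function.update_self]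
        have h1 := hc (x - v e x • u) ⟨X.sub_mem hx (X.smul_mem _ hu), by simp [hu1]⟩
        have h2 : ∑ i ∈ T, Function.update c e (-s) i * v i x = ∑ i ∈ T, c i * v i x := by
          refine Finset.sum_congr rfl fun i hi => ?_
          rw [Function.update_of_ne (by rintro rfl; exact heT hi)]
        rw [h2]
        have h3 : ∑ i ∈ T, c i * v i (x - v e x • u) = ∑ i ∈ T, c i * v i x - v e x * s := by
          rw [hs, Finset.mul_sum, ← Finset.sum_sub_distrib]
          refine Finset.sum_congr rfl fun i _ => ?_
          rw [map_sub, map_smul, smul_eq_mul]; ring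
        rw [h3] at h1
        linear_combination h1
      convert hr using 1
      rw [pe_relp heT, map_mul, map_prod]
      have h4 : ∏ j ∈ T, pe e (MvPolynomial.X j : MvPolynomial ι K)
          = ∏ j ∈ T, MvPolynomial.X j := by
        refine Finset.prod_congr rfl fun j hj => pe_X_ne ?_
        rintro rfl; exact heT hj
      rw [h4, relp, relp, Finset.sum_insert heT, Function.update_self, Finset.erase_insert heT]
      have h5 : ∑ i ∈ T, C (Function.update c e (-s) i) *
            ∏ j ∈ (insert e T).erase i, (MvPolynomial.X j : MvPolynomial ι K)
          = MvPolynomial.X e * ∑ i ∈ T, C (c i) * ∏ j ∈ T.erase i, MvPolynomial.X j := by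
        rw [Finset.mul_sum]
        refine Finset.sum_congr rfl fun i hi => ?_
        have hie : i ≠ e := by rintro rfl; exact heT hi
        rw [Function.update_of_ne hie, Finset.erase_insert_of_ne hie.symm,
          Finset.prod_insert (by simp [heT])]
        ring
      rw [h5]
      simp only [pe, algHom_C, algebraMap_eq, map_neg]
      ring
  · rintro a b _ _ ⟨g, hg⟩ ⟨g', hg'⟩
    refine ⟨g + g', ?_⟩
    have := Ideal.add_mem _ hg hg'
    rw [map_add, map_add]; convert this using 1; ring
  · rintro a b _ ⟨g, hg⟩
    refine ⟨a * g, ?_⟩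
    have := Ideal.mul_mem_left _ (pe e a) hg
    rw [smul_eq_mul, map_mul, map_mul]; convert this using 1; ring

lemma UU_of_insert {v : ι → W →ₗ[K] K} {E : Finset ι} {X : Submodule K W} {e : ι} {x : W} :
    x ∈ UU v (insert e E) X ↔ x ∈ UU v E X ∧ v e x ≠ 0 := by
  simp only [UU, Set.mem_ofPred_eq, Finset.mem_insert, forall_eq_or_imp]; tauto

/-- A function on the complement which is `v_e` times a regular function vanishes on the
hyperplane. -/
lemma mem_B [Infinite K] {v : ι → W →ₗ[K] K} {E : Finset ι} {X : Submodule K W} {e : ι}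
    {u : W} (hu : u ∈ X) (hu1 : v e u = 1) {f g : MvPolynomial ι K}
    (h : ∀ x ∈ UU v (insert e E) X, eval (yv v E x) f = v e x * eval (yv v E x) g) :
    f ∈ II v E (X ⊓ LinearMap.ker (v e)) := by
  refine mem_II.2 fun x hx => ?_
  have hxe : v e x = 0 := hx.1.2
  have r1 := (isRat_eval v E x u f).add
    ((IsRat.poly (lineD v E x u) (-Polynomial.X)).mul (isRat_eval v E x u g))
  have := r1.zero (lineD_ne.2 (by simpa using hx.2)) (p := Polynomial.X) Polynomial.X_ne_zero
    (fun t ht ht0 => by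
      have hmem : x + t • u ∈ UU v (insert e E) X := by
        rw [UU_of_insert]
        refine ⟨⟨X.add_mem hx.1.1 (X.smul_mem _ hu), lineD_ne.1 ht⟩, ?_⟩
        simpa [hxe, hu1] using ht0
      have h' := h _ hmem
      simp only [map_add, map_smul, hxe, hu1, smul_eq_mul, mul_one, zero_add] at h'
      simp only [h', Polynomial.eval_neg, Polynomial.eval_X]; ring)
  simpa using this

/-- Density. -/
lemma mem_A [Infinite K] {v : ι → W →ₗ[K] K} {E : Finset ι} {X : Submodule K W} {e : ι}
    {u : W} (hu : u ∈ X) (hu1 : v e u = 1) {f : MvPolynomial ι K}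
    (h : ∀ x ∈ UU v (insert e E) X, eval (yv v E x) f = 0) :
    f ∈ II v E X := by
  refine mem_II.2 fun x hx => ?_
  have := (isRat_eval v E x u f).zero (lineD_ne.2 (by simpa using hx.2))
    (p := Polynomial.C (v e x) + Polynomial.X) (by
      intro h0
      have := congrArg (fun p => Polynomial.coeff p 1) h0
      simp at this)
    (fun t ht ht0 => by
      refine h _ (UU_of_insert.2 ⟨⟨X.add_mem hx.1 (X.smul_mem _ hu), lineD_ne.1 ht⟩, ?_⟩)
      simpa [hu1] using ht0)
  simpa using this

lemma red [Infinite K] {v : ι → W →ₗ[K] K} {E : Finset ι} {X : Submodule K W} {e : ι} (he : e ∉ E)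
    {u : W} (hu : u ∈ X) (hu1 : v e u = 1)
    (hB : II v E (X ⊓ LinearMap.ker (v e)) ≤ Circ v E (X ⊓ LinearMap.ker (v e)))
    (g : MvPolynomial ι K) (N : ℕ) (c : ℕ → MvPolynomial ι K)
    (h : ∀ x ∈ UU v (insert e E) X, eval (yv v (insert e E) x)
      (∑ k ∈ Finset.range (N + 1), MvPolynomial.X e ^ k * pe e (c k))
        = v e x * eval (yv v E x) g) :
    ∃ f0, (∑ k ∈ Finset.range (N + 1), MvPolynomial.X e ^ k * pe e (c k)) - pe e f0
      ∈ Circ v (insert e E) X := by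
  induction N generalizing c with
  | zero => exact ⟨c 0, by simp⟩
  | succ N ih =>
    have hc : c (N + 1) ∈ II v E (X ⊓ LinearMap.ker (v e)) := by
      refine mem_II.2 fun x hx => ?_
      have hxe : v e x = 0 := hx.1.2
      have r1 := (IsRat.sum (Finset.range (N + 1 + 1)) fun k _ =>
          (IsRat.poly (lineD v E x u) (Polynomial.X ^ (N + 1 - k))).mul
            (isRat_eval v E x u (c k))).add
        ((IsRat.poly (lineD v E x u) (-Polynomial.X ^ (N + 2))).mul (isRat_eval v E x u g))
      have := r1.zero (lineD_ne.2 (by simpa using hx.2)) (p := Polynomial.X)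
        Polynomial.X_ne_zero
        (fun t ht ht0 => by
          have hmem : x + t • u ∈ UU v (insert e E) X := by
            rw [UU_of_insert]
            refine ⟨⟨X.add_mem hx.1.1 (X.smul_mem _ hu), lineD_ne.1 ht⟩, ?_⟩
            simpa [hxe, hu1] using ht0
          have h' := h _ hmem
          have ht1 : t ≠ 0 := by simpa using ht0
          simp only [map_sum, map_mul, map_pow, eval_pe he] at h'
          simp only [map_add, map_smul, hxe, hu1, smul_eq_mul, mul_one, zero_add, yv, eval_X,
            Finset.mem_insert_self, if_true] at h'
          have h2 : ∑ k ∈ Finset.range (N + 1 + 1), t ^ (N + 1 - k) *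
              eval (yv v E (x + t • u)) (c k) = t ^ (N + 2) * eval (yv v E (x + t • u)) g := by
            have : t ^ (N + 2) * eval (yv v E (x + t • u)) g
              = t ^ (N + 1) * (t * eval (yv v E (x + t • u)) g) := by ring
            rw [this, ← h', Finset.mul_sum]
            refine Finset.sum_congr rfl fun k hk => ?_
            have hk' : k ≤ N + 1 := by have := Finset.mem_range.1 hk; omega
            rw [← mul_assoc]
            congr 1
            rw [inv_pow, ← div_eq_mul_inv, eq_div_iff (pow_ne_zero _ ht1), ← pow_add]
            congr 1; omega
          simp only [Polynomial.eval_pow, Polynomial.eval_X, Polynomial.eval_neg]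
          rw [h2]; ring)
      rw [Finset.sum_range_succ] at this
      simp only [Polynomial.eval_pow, Polynomial.eval_X, Polynomial.eval_neg] at this
      rw [Finset.sum_eq_zero] at this
      · simpa using this
      · intro k hk
        have hk' := Finset.mem_range.1 hk
        rw [zero_pow (by omega), zero_mul]
    obtain ⟨g', hg'⟩ := core he hu hu1 (hB hc)
    have hdiff : (∑ k ∈ Finset.range (N + 1 + 1), MvPolynomial.X e ^ k * pe e (c k))
        - (∑ k ∈ Finset.range (N + 1), MvPolynomial.X e ^ k *
            pe e (Function.update c N (c N + g') k)) ∈ Circ v (insert e E) X := by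
      have := Ideal.mul_mem_left _ (MvPolynomial.X e ^ N) hg'
      convert this using 1
      rw [Finset.sum_range_succ, Finset.sum_range_succ, Finset.sum_range_succ _ N,
        Function.update_self]
      have : ∑ k ∈ Finset.range N, MvPolynomial.X e ^ k *
            pe e (Function.update c N (c N + g') k)
          = ∑ k ∈ Finset.range N, MvPolynomial.X e ^ k * pe e (c k) := by
        refine Finset.sum_congr rfl fun k hk => ?_
        rw [Function.update_of_ne (Finset.mem_range.1 hk).ne]
      rw [this, map_add]; ring
    obtain ⟨f0, hf0⟩ := ih (Function.update c N (c N + g')) (fun x hx => by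
      have h1 := mem_II.1 (Circ_le_II _ _ _ hdiff) x hx
      rw [map_sub, h x hx, sub_eq_zero] at h1
      exact h1.symm)
    refine ⟨f0, ?_⟩
    have := Ideal.add_mem _ hdiff hf0
    convert this using 1; ring

lemma red' [Infinite K] {v : ι → W →ₗ[K] K} {E : Finset ι} {X : Submodule K W} {e : ι}
    (he : e ∉ E) {u : W} (hu : u ∈ X) (hu1 : v e u = 1)
    (hB : II v E (X ⊓ LinearMap.ker (v e)) ≤ Circ v E (X ⊓ LinearMap.ker (v e)))
    (f g : MvPolynomial ι K)
    (h : ∀ x ∈ UU v (insert e E) X, eval (yv v (insert e E) x) f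
        = v e x * eval (yv v E x) g) :
    ∃ f0, f - pe e f0 ∈ Circ v (insert e E) X := by
  obtain ⟨N, c, rfl⟩ := exists_rep e f
  exact red he hu hu1 hB g N c h

lemma II_eq_top {v : ι → W →ₗ[K] K} {E : Finset ι} {X : Submodule K W} {e : ι} (he : e ∈ E)
    (h : ∀ x ∈ X, v e x = 0) : II v E X = ⊤ := by
  refine (Ideal.eq_top_iff_one _).2 (mem_II.2 fun x hx => ?_)
  exact absurd (h x hx.1) (hx.2 e he)

lemma exists_u {v : ι → W →ₗ[K] K} {X : Submodule K W} {e : ι}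
    (h : ¬ ∀ x ∈ X, v e x = 0) : ∃ u ∈ X, v e u = 1 := by
  push Not at h
  obtain ⟨x, hx, hne⟩ := h
  exact ⟨(v e x)⁻¹ • x, X.smul_mem _ hx, by simp [hne]⟩

theorem II_le_Circ [Infinite K] (v : ι → W →ₗ[K] K) (E : Finset ι) :
    ∀ X : Submodule K W, II v E X ≤ Circ v E X := by
  induction E using Finset.induction_on with
  | empty =>
    intro X f hf
    have h0 := mem_II.1 hf 0 ⟨X.zero_mem, by simp⟩
    have hy : yv v ∅ (0 : W) = 0 := by ext i; simp [yv]
    rw [hy] at h0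
    have key : ∀ f : MvPolynomial ι K, f - C (eval 0 f) ∈ Circ v ∅ X := by
      intro f
      induction f using MvPolynomial.induction_on with
      | C a => simp
      | add p q hp hq =>
        have := Ideal.add_mem _ hp hq
        rw [map_add, map_add]; convert this using 1; ring
      | mul_X p i hp =>
        simp only [map_mul, eval_X, Pi.zero_apply, mul_zero, map_zero, sub_zero]
        exact Ideal.mul_mem_left _ _ (X_mem_Circ (by simp))
    have := key f
    rwa [h0, map_zero, sub_zero] at this
  | insert e E he ih =>
    intro X f hf
    by_cases hX : ∀ x ∈ X, v e x = 0
    · have h1 := relp_mem_Circ (v := v) (X := X) (E := insert e E) (T := {e}) (c := fun _ => 1)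
        (by simp) (by simpa using hX)
      have : (1 : MvPolynomial ι K) ∈ Circ v (insert e E) X := by
        simpa [relp] using h1
      rw [(Ideal.eq_top_iff_one _).2 this]; trivial
    · obtain ⟨u, hu, hu1⟩ := exists_u hX
      obtain ⟨f0, hf0⟩ := red' he hu hu1 (ih _) f 0 (by simpa using mem_II.1 hf)
      have h2 : f0 ∈ II v E X := mem_A hu hu1 (fun x hx => by
        have := mem_II.1 (Circ_le_II _ _ _ hf0) x hx
        rw [map_sub, mem_II.1 hf x hx, eval_pe he] at this
        simpa using this)
      have h3 := pe_mem_Circ he (ih X h2)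
      have := Ideal.add_mem _ hf0 h3
      simpa using this

end Recip



/-! ### Deletion-restriction for the coordinate rings -/

section DelRes

open MvPolynomial

variable {K : Type} [Field K] {W : Type} [AddCommGroup W] [Module K W]

/-- The relation `f = v_e g` on the complement. -/
def Rel (v : ι → W →ₗ[K] K) (e : ι) (E : Finset ι) (X : Submodule K W)
    (f g : MvPolynomial ι K) : Prop :=
  ∀ x ∈ UU v (insert e E) X, eval (yv v E x) f = v e x * eval (yv v E x) g

/-- The ideal of the section of the reciprocal space by `y_e = 0`. -/
def DD (v : ι → W →ₗ[K] K) (e : ι) (E : Finset ι) (X : Submodule K W) :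
    Ideal (MvPolynomial ι K) :=
  II v (insert e E) X ⊔ Ideal.span {(MvPolynomial.X e : MvPolynomial ι K)}

variable {v : ι → W →ₗ[K] K} {E : Finset ι} {X : Submodule K W} {e : ι}

lemma A_le_B : II v E X ≤ II v E (X ⊓ LinearMap.ker (v e)) := by
  intro f hf
  refine mem_II.2 fun x hx => mem_II.1 hf x ⟨hx.1.1, hx.2⟩

lemma I_le_DD : II v (insert e E) X ≤ DD v e E X := le_sup_left

lemma X_mem_DD : (MvPolynomial.X e : MvPolynomial ι K) ∈ DD v e E X :=
  Ideal.mem_sup_right (Ideal.subset_span rfl)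

lemma sub_pe_mem_DD (f : MvPolynomial ι K) : f - pe e f ∈ DD v e E X :=
  Ideal.mem_sup_right (sub_pe_mem e f)

lemma A_le_DD (he : e ∉ E) : II v E X ≤ DD v e E X := by
  intro f hf
  have h1 : pe e f ∈ II v (insert e E) X := by
    refine mem_II.2 fun x hx => ?_
    rw [eval_pe he]
    exact mem_II.1 hf x (UU_of_insert.1 hx).1
  have := Ideal.add_mem _ (sub_pe_mem_DD (v := v) (E := E) (X := X) (e := e) f) (I_le_DD h1)
  simpa using this

lemma B_le_A {u : W} (hu : u ∈ X) (hu1 : v e u = 1) (h0 : ∀ i ∈ E, v i u = 0) :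
    II v E (X ⊓ LinearMap.ker (v e)) ≤ II v E X := by
  intro f hf
  refine mem_II.2 fun x hx => ?_
  have hv : ∀ i ∈ E, v i (x - v e x • u) = v i x := fun i hi => by simp [h0 i hi]
  have h1 := mem_II.1 hf (x - v e x • u)
    ⟨⟨X.sub_mem hx.1 (X.smul_mem _ hu), by simp [hu1]⟩, fun i hi => by
      rw [hv i hi]; exact hx.2 i hi⟩
  have h2 : yv v E (x - v e x • u) = yv v E x := by
    ext i
    by_cases hi : i ∈ E
    · simp only [yv, hi, if_true, hv i hi]
    · simp only [yv, hi, if_false]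
  rwa [h2] at h1

lemma X_reg {f : MvPolynomial ι K} (h : MvPolynomial.X e * f ∈ II v (insert e E) X) :
    f ∈ II v (insert e E) X := by
  refine mem_II.2 fun x hx => ?_
  have h1 := mem_II.1 h x hx
  have h2 := (UU_of_insert.1 hx).2
  rw [map_mul, eval_X] at h1
  simpa [yv, h2] using h1

lemma Rel_zero_left [Infinite K] {u : W} (hu : u ∈ X) (hu1 : v e u = 1) {g : MvPolynomial ι K} :
    Rel v e E X 0 g ↔ g ∈ II v E X := by
  constructor
  · intro h
    refine mem_A hu hu1 fun x hx => ?_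
    have := h x hx
    have h2 := (UU_of_insert.1 hx).2
    simpa [h2] using this.symm
  · intro h x hx
    rw [mem_II.1 h x (UU_of_insert.1 hx).1]; simp

lemma Rel_zero_right [Infinite K] {u : W} (hu : u ∈ X) (hu1 : v e u = 1) {f : MvPolynomial ι K} :
    Rel v e E X f 0 ↔ f ∈ II v E X := by
  constructor
  · intro h
    refine mem_A hu hu1 fun x hx => ?_
    simpa using h x hx
  · intro h x hx
    rw [mem_II.1 h x (UU_of_insert.1 hx).1]; simp

lemma Rel.add {f g f' g' : MvPolynomial ι K} (h : Rel v e E X f g) (h' : Rel v e E X f' g') :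
    Rel v e E X (f + f') (g + g') := fun x hx => by
  rw [map_add, map_add, h x hx, h' x hx]; ring

lemma Rel.mul {f g : MvPolynomial ι K} (a : MvPolynomial ι K) (h : Rel v e E X f g) :
    Rel v e E X (a * f) (a * g) := fun x hx => by
  rw [map_mul, map_mul, h x hx]; ring

lemma exists_Rel_of_B [Infinite K] (he : e ∉ E) {u : W} (hu : u ∈ X) (hu1 : v e u = 1)
    {f : MvPolynomial ι K} (hf : f ∈ II v E (X ⊓ LinearMap.ker (v e))) :
    ∃ g ∈ DD v e E X, Rel v e E X f g := by
  obtain ⟨g, hg⟩ := core he hu hu1 (II_le_Circ v E _ hf)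
  have hg' := Circ_le_II _ _ _ hg
  refine ⟨g, ?_, fun x hx => ?_⟩
  · have h1 := Ideal.sub_mem _ (Ideal.mul_mem_right (pe e f) _ (X_mem_DD (v := v) (E := E) (X := X)
      (e := e))) (I_le_DD hg')
    have := Ideal.add_mem _ (sub_pe_mem_DD (v := v) (E := E) (X := X) (e := e) g) h1
    convert this using 1; ring
  · have h1 := mem_II.1 hg' x hx
    have h2 := (UU_of_insert.1 hx).2
    rw [map_sub, map_mul, eval_pe he, eval_pe he, eval_X] at h1
    simp only [yv, Finset.mem_insert_self, if_true] at h1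
    change (v e x)⁻¹ * eval (yv v E x) f - eval (yv v E x) g = 0 at h1
    rw [sub_eq_zero] at h1
    rw [← h1]; field_simp

lemma exists_Rel_of_DD [Infinite K] (he : e ∉ E) {u : W} (hu : u ∈ X) (hu1 : v e u = 1)
    {g : MvPolynomial ι K} (hg : g ∈ DD v e E X) :
    ∃ f ∈ II v E (X ⊓ LinearMap.ker (v e)), Rel v e E X f g := by
  have h1 : pe e g ∈ DD v e E X := by
    have := Ideal.sub_mem _ hg (sub_pe_mem_DD (v := v) (E := E) (X := X) (e := e) g)
    simpa using this
  obtain ⟨h, hh, b, hb, hsum⟩ := Submodule.mem_sup.1 h1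
  obtain ⟨a, rfl⟩ := Ideal.mem_span_singleton'.1 hb
  have h2 : ∀ x ∈ UU v (insert e E) X, eval (yv v (insert e E) x) a
        = v e x * eval (yv v E x) g := fun x hx => by
    have h3 := congrArg (eval (yv v (insert e E) x)) hsum
    have h4 := (UU_of_insert.1 hx).2
    rw [map_add, mem_II.1 hh x hx, zero_add, eval_pe he, map_mul, eval_X] at h3
    rw [← h3]
    simp only [yv, Finset.mem_insert_self, if_true]
    field_simp
  obtain ⟨f0, hf0⟩ := red' he hu hu1 (II_le_Circ v E _) a g h2
  have h5 : Rel v e E X f0 g := fun x hx => by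
    have := mem_II.1 (Circ_le_II _ _ _ hf0) x hx
    rw [map_sub, eval_pe he, sub_eq_zero] at this
    rw [← this, h2 x hx]
  exact ⟨f0, mem_B hu hu1 h5, h5⟩

variable (v E X e) in
/-- The graph of multiplication by `v_e`. -/
def PP : Submodule (MvPolynomial ι K) (MvPolynomial ι K × MvPolynomial ι K) where
  carrier := {p | p.1 ∈ II v E (X ⊓ LinearMap.ker (v e)) ∧ p.2 ∈ DD v e E X ∧ Rel v e E X p.1 p.2}
  add_mem' := fun ha hb => ⟨Ideal.add_mem _ ha.1 hb.1, Ideal.add_mem _ ha.2.1 hb.2.1,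
    ha.2.2.add hb.2.2⟩
  zero_mem' := ⟨Ideal.zero_mem _, Ideal.zero_mem _, fun x _ => by simp⟩
  smul_mem' := fun c _ ha => ⟨Ideal.mul_mem_left _ c ha.1, Ideal.mul_mem_left _ c ha.2.1,
    ha.2.2.mul c⟩

lemma factor_exact {R : Type} [CommRing R] {A B : Ideal R} (h : A ≤ B)
    {M : Type} [AddCommGroup M] [Module R M] (f : M →ₗ[R] R ⧸ A)
    (hf : ∀ b ∈ B, ∃ m, f m = Submodule.Quotient.mk b)
    (hf' : ∀ m, ∃ b ∈ B, f m = Submodule.Quotient.mk b) :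
    Function.Exact f (Submodule.factor h) := by
  intro y
  obtain ⟨b, rfl⟩ := Submodule.Quotient.mk_surjective _ y
  constructor
  · intro hb
    obtain ⟨m, hm⟩ := hf b ((Submodule.Quotient.mk_eq_zero _).1 hb)
    exact ⟨m, hm⟩
  · rintro ⟨m, hm⟩
    obtain ⟨b', hb', hm'⟩ := hf' m
    rw [← hm, hm']
    exact (Submodule.Quotient.mk_eq_zero _).2 hb'

lemma factor_surj {R : Type} [CommRing R] {A B : Ideal R} (h : A ≤ B) :
    Function.Surjective (Submodule.factor h) := by
  intro y
  obtain ⟨b, rfl⟩ := Submodule.Quotient.mk_surjective _ y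
  exact ⟨Submodule.Quotient.mk b, rfl⟩

lemma lsmul_inj {R : Type} [CommRing R] {I : Ideal R} {s : R} (h : ∀ f, s * f ∈ I → f ∈ I) :
    Function.Injective (LinearMap.lsmul R (R ⧸ I) s) := by
  rw [← LinearMap.ker_eq_bot, LinearMap.ker_eq_bot']
  intro y hy
  obtain ⟨b, rfl⟩ := Submodule.Quotient.mk_surjective _ y
  exact (Submodule.Quotient.mk_eq_zero _).2 (h b ((Submodule.Quotient.mk_eq_zero _).1 hy))

lemma lsmul_exact {R : Type} [CommRing R] {I J : Ideal R} {s : R} (hJ : I ≤ J)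
    (h : J = I ⊔ Ideal.span {s}) :
    Function.Exact (LinearMap.lsmul R (R ⧸ I) s) (Submodule.factor hJ) := by
  refine factor_exact _ _ ?_ ?_
  · intro b hb
    rw [h] at hb
    obtain ⟨a, ha, c, hc, rfl⟩ := Submodule.mem_sup.1 hb
    obtain ⟨t, rfl⟩ := Ideal.mem_span_singleton'.1 hc
    refine ⟨Submodule.Quotient.mk t, ?_⟩
    change Submodule.Quotient.mk (s * t) = _
    refine (Submodule.Quotient.eq _).2 ?_
    convert I.neg_mem ha using 1
    ring
  · intro y
    obtain ⟨b, rfl⟩ := Submodule.Quotient.mk_surjective _ y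
    refine ⟨s * b, ?_, rfl⟩
    rw [h]
    exact Ideal.mul_mem_right _ _ (Ideal.mem_sup_right (Ideal.subset_span rfl))

/-- One step of the depth induction. -/
lemma dep_step [Infinite K] (he : e ∉ E) {u : W} (hu : u ∈ X) (hu1 : v e u = 1)
    {m : Ideal (MvPolynomial ι K)} (hm : MvPolynomial.X e ∈ m) {r : ℕ}
    (hB : Dep m r (MvPolynomial ι K ⧸ II v E (X ⊓ LinearMap.ker (v e))))
    (hA : Dep m (r + 1) (MvPolynomial ι K ⧸ II v E X) ∨
      II v E (X ⊓ LinearMap.ker (v e)) ≤ II v E X) :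
    Dep m (r + 1) (MvPolynomial ι K ⧸ II v (insert e E) X) := by
  have hA' : Dep m r (MvPolynomial ι K ⧸ II v E X) := by
    rcases hA with hA | hA
    · exact hA.mono (by omega)
    · rwa [le_antisymm A_le_B hA]
  let S := MvPolynomial ι K
  let φ : PP v E X e →ₗ[S] S ⧸ II v E X :=
    (Submodule.mkQ _) ∘ₗ (LinearMap.fst S S S) ∘ₗ (PP v E X e).subtype
  let ψ : PP v E X e →ₗ[S] S ⧸ II v E X :=
    (Submodule.mkQ _) ∘ₗ (LinearMap.snd S S S) ∘ₗ (PP v E X e).subtype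
  have hφ : ∀ p : PP v E X e, φ p = Submodule.Quotient.mk p.1.1 := fun p => rfl
  have hψ : ∀ p : PP v E X e, ψ p = Submodule.Quotient.mk p.1.2 := fun p => rfl
  have hker : LinearMap.ker φ = LinearMap.ker ψ := by
    ext p
    rw [LinearMap.mem_ker, LinearMap.mem_ker, hφ, hψ, Submodule.Quotient.mk_eq_zero,
      Submodule.Quotient.mk_eq_zero]
    have hR := p.2.2.2
    constructor
    · intro h
      have h1 := hR.add ((Rel_zero_right hu hu1).2 ((II v E X).neg_mem h))
      rw [add_neg_cancel, add_zero] at h1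
      exact (Rel_zero_left hu hu1).1 h1
    · intro h
      have h1 := hR.add ((Rel_zero_left hu hu1).2 ((II v E X).neg_mem h))
      rw [add_neg_cancel, add_zero] at h1
      exact (Rel_zero_right hu hu1).1 h1
  let eq : LinearMap.range φ ≃ₗ[S] LinearMap.range ψ :=
    (φ.quotKerEquivRange.symm.trans (Submodule.quotEquivOfEq _ _ hker)).trans
      ψ.quotKerEquivRange
  have hrφ : Dep m (r + 1) (LinearMap.range φ) := by
    have ex : Function.Exact (LinearMap.range φ).subtype
        (Submodule.factor (A_le_B (v := v) (E := E) (X := X) (e := e))) := by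
      refine factor_exact _ _ ?_ ?_
      · intro b hb
        obtain ⟨g, hg, hR⟩ := exists_Rel_of_B he hu hu1 hb
        exact ⟨⟨_, ⟨⟨(b, g), hb, hg, hR⟩, rfl⟩⟩, rfl⟩
      · rintro ⟨_, ⟨p, rfl⟩⟩
        exact ⟨p.1.1, p.2.1, rfl⟩
    rcases hA with hA | hA
    · exact Dep.left (Submodule.subtype_injective _) ex (factor_surj _) hA hB
    · have : Subsingleton (LinearMap.range φ) := by
        refine ⟨fun a b => ?_⟩
        have : ∀ a : LinearMap.range φ, a = 0 := by
          rintro ⟨_, ⟨p, rfl⟩⟩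
          refine Subtype.ext ?_
          exact (Submodule.Quotient.mk_eq_zero _).2 (hA p.2.1)
        rw [this a, this b]
      exact Dep.of_subsingleton _
  have hrψ : Dep m (r + 1) (LinearMap.range ψ) := hrφ.of_equiv eq
  have ex : Function.Exact (LinearMap.range ψ).subtype
      (Submodule.factor (A_le_DD (v := v) (X := X) he)) := by
    refine factor_exact _ _ ?_ ?_
    · intro b hb
      obtain ⟨f, hf, hR⟩ := exists_Rel_of_DD he hu hu1 hb
      exact ⟨⟨_, ⟨⟨(f, b), hf, hb, hR⟩, rfl⟩⟩, rfl⟩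
    · rintro ⟨_, ⟨p, rfl⟩⟩
      exact ⟨p.1.2, p.2.2.1, rfl⟩
  have hD : Dep m r (S ⧸ DD v e E X) :=
    Dep.right (Submodule.subtype_injective _) ex (factor_surj _) hA' hrψ
  exact Dep.of_smul hm (lsmul_inj fun f hf => X_reg hf) (lsmul_exact _ rfl)
    (factor_surj (I_le_DD (v := v) (E := E) (X := X) (e := e))) hD

end DelRes


/-! ### Depth of the coordinate rings -/

section Depth

open MvPolynomial

variable {K : Type} [Field K] {W : Type} [AddCommGroup W] [Module K W] [FiniteDimensional K W]

lemma finrank_H {v : ι → W →ₗ[K] K} {X : Submodule K W} {e : ι} {u : W} (hu : u ∈ X)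
    (hu1 : v e u = 1) :
    Module.finrank K (X ⊓ LinearMap.ker (v e) : Submodule K W) + 1 = Module.finrank K X := by
  have h1 := LinearMap.finrank_range_add_finrank_ker ((v e) ∘ₗ X.subtype)
  have h2 : LinearMap.range ((v e) ∘ₗ X.subtype) = ⊤ := by
    refine LinearMap.range_eq_top.2 fun c => ⟨c • ⟨u, hu⟩, ?_⟩
    simp [hu1]
  have h3 : Module.finrank K (LinearMap.ker ((v e) ∘ₗ X.subtype))
      = Module.finrank K (X ⊓ LinearMap.ker (v e) : Submodule K W) := by
    rw [← Submodule.map_comap_subtype, Submodule.finrank_map_subtype_eq, LinearMap.ker_comp]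
  rw [h2, h3, finrank_top, Module.finrank_self] at h1
  omega

/-- The forms indexed by `E` separate the points of `X`. -/
def Spans (v : ι → W →ₗ[K] K) (E : Finset ι) (X : Submodule K W) : Prop :=
  ∀ x ∈ X, (∀ i ∈ E, v i x = 0) → x = 0

lemma Spans.restrict {v : ι → W →ₗ[K] K} {X : Submodule K W} {e : ι} {E : Finset ι}
    (h : Spans v (insert e E) X) : Spans v E (X ⊓ LinearMap.ker (v e)) := by
  intro x hx h0
  refine h x hx.1 fun i hi => ?_
  rcases Finset.mem_insert.1 hi with rfl | hi
  · exact hx.2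
  · exact h0 i hi

lemma Spans.coloop {v : ι → W →ₗ[K] K} {X : Submodule K W} {e : ι} {E : Finset ι}
    (h : Spans v (insert e E) X) (h' : ¬ Spans v E X) :
    ∃ u ∈ X, v e u = 1 ∧ ∀ i ∈ E, v i u = 0 := by
  unfold Spans at h'
  push Not at h'
  obtain ⟨x, hx, h0, hne⟩ := h'
  have hve : v e x ≠ 0 := fun h1 => hne (h x hx fun i hi => by
    rcases Finset.mem_insert.1 hi with rfl | hi
    · exact h1
    · exact h0 i hi)
  exact ⟨(v e x)⁻¹ • x, X.smul_mem _ hx, by simp [hve], fun i hi => by simp [h0 i hi]⟩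

theorem dep_II [Infinite K] (v : ι → W →ₗ[K] K) {m : Ideal (MvPolynomial ι K)}
    (hm : ∀ i, MvPolynomial.X i ∈ m) (E : Finset ι) :
    ∀ X : Submodule K W, Spans v E X →
      Dep m (Module.finrank K X) (MvPolynomial ι K ⧸ II v E X) := by
  induction E using Finset.induction_on with
  | empty =>
    intro X hX
    have : X = ⊥ := (Submodule.eq_bot_iff _).2 fun x hx => hX x hx (by simp)
    subst this
    rw [finrank_bot]
    intro i hi
    omega
  | insert e E he ih =>
    intro X hX
    by_cases h0 : ∀ x ∈ X, v e x = 0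
    · rw [II_eq_top (Finset.mem_insert_self e E) h0]
      exact Dep.of_subsingleton _
    obtain ⟨u, hu, hu1⟩ := exists_u h0
    have hr := finrank_H hu hu1
    rw [← hr]
    refine dep_step he hu hu1 (hm e) (ih _ hX.restrict) ?_
    by_cases hE : Spans v E X
    · left; rw [hr]; exact ih X hE
    · right
      obtain ⟨u', hu', h1, h2⟩ := hX.coloop hE
      exact B_le_A hu' h1 h2

end Depth


/-! ### Hilbert functions -/

section Hilb

open MvPolynomial

attribute [local instance] MvPolynomial.gradedAlgebra

variable {K : Type} [Field K]

/-- Homogeneous ideals. -/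
def HomI (I : Ideal (MvPolynomial ι K)) : Prop := ∀ f ∈ I, ∀ q, homogeneousComponent q f ∈ I

lemma HomI_iff {I : Ideal (MvPolynomial ι K)} :
    HomI I ↔ I.IsHomogeneous (homogeneousSubmodule ι K) := by
  constructor
  · intro h q f hf
    rw [← DirectSum.Decomposition.decompose'_eq, decomposition.decompose'_apply]
    exact h f hf q
  · intro h f hf q
    have := h q hf
    rwa [← DirectSum.Decomposition.decompose'_eq, decomposition.decompose'_apply] at this

lemma HomI.sup {I J : Ideal (MvPolynomial ι K)} (hI : HomI I) (hJ : HomI J) : HomI (I ⊔ J) :=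
  HomI_iff.2 ((HomI_iff.1 hI).sup (HomI_iff.1 hJ))

lemma HomI_span {s : Set (MvPolynomial ι K)}
    (h : ∀ x ∈ s, x ∈ homogeneousSubmodule ι K 1) : HomI (Ideal.span s) :=
  HomI_iff.2 (Ideal.homogeneous_span _ _ fun x hx => ⟨1, h x hx⟩)

lemma comp_mul {s : MvPolynomial ι K} (hs : s ∈ homogeneousSubmodule ι K 1)
    (f : MvPolynomial ι K) (q : ℕ) :
    homogeneousComponent (q + 1) (s * f) = s * homogeneousComponent q f := by
  have := DirectSum.coe_decompose_mul_add_of_left_mem (homogeneousSubmodule ι K) (i := 1) (j := q)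
    (b := f) hs
  rw [← DirectSum.Decomposition.decompose'_eq, decomposition.decompose'_apply,
    decomposition.decompose'_apply] at this
  rwa [add_comm] at this

instance finite_homog (q : ℕ) : Module.Finite K (homogeneousSubmodule ι K q) :=
  Module.Finite.iff_fg.2 (homogeneousSubmodule_fg ι K q)

/-- Graded pieces of an ideal. -/
def gr (I : Ideal (MvPolynomial ι K)) (q : ℕ) : Submodule K (MvPolynomial ι K) :=
  I.restrictScalars K ⊓ homogeneousSubmodule ι K q

instance finite_gr (I : Ideal (MvPolynomial ι K)) (q : ℕ) : Module.Finite K (gr I q) :=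
  Submodule.finiteDimensional_of_le inf_le_right

lemma mem_gr {I : Ideal (MvPolynomial ι K)} {q : ℕ} {f : MvPolynomial ι K} :
    f ∈ gr I q ↔ f ∈ I ∧ f ∈ homogeneousSubmodule ι K q := Iff.rfl

lemma dim_exact {A M N : Type} [AddCommGroup A] [Module K A] [AddCommGroup M] [Module K M]
    [AddCommGroup N] [Module K N] [Module.Finite K M] (f : A →ₗ[K] M) (g : M →ₗ[K] N)
    (hf : Function.Injective f) (hfg : Function.Exact f g) (hg : Function.Surjective g) :
    Module.finrank K M = Module.finrank K A + Module.finrank K N := by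
  have h1 := LinearMap.finrank_range_add_finrank_ker g
  rw [LinearMap.range_eq_top.2 hg, finrank_top, LinearMap.exact_iff.1 hfg,
    LinearMap.finrank_range_of_inj hf] at h1
  omega

lemma hilb_add (I : Ideal (MvPolynomial ι K)) (q : ℕ) :
    hilb K I q + Module.finrank K (gr I q) = Module.finrank K (homogeneousSubmodule ι K q) := by
  let φ := (Ideal.Quotient.mkₐ K I).toLinearMap.submoduleMap (homogeneousSubmodule ι K q)
  have := dim_exact (Submodule.inclusion (show gr I q ≤ homogeneousSubmodule ι K q from inf_le_right)) φ
    (Submodule.inclusion_injective _) ?_ (LinearMap.submoduleMap_surjective _ _)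
  · rw [this, hilb]; omega
  · intro x
    rw [← Submodule.coe_eq_zero]
    change Ideal.Quotient.mk I x.1 = 0 ↔ _
    rw [Ideal.Quotient.eq_zero_iff_mem]
    constructor
    · intro h
      exact ⟨⟨x.1, h, x.2⟩, rfl⟩
    · rintro ⟨y, rfl⟩
      exact y.2.1

lemma hilb_reg {I : Ideal (MvPolynomial ι K)} (hI : HomI I) {s : MvPolynomial ι K}
    (hs : s ∈ homogeneousSubmodule ι K 1) (hreg : ∀ f, s * f ∈ I → f ∈ I) (q : ℕ) :
    hilb K I (q + 1) = hilb K I q + hilb K (I ⊔ Ideal.span {s}) (q + 1) := by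
  have hsmem : ∀ f ∈ homogeneousSubmodule ι K q, s * f ∈ homogeneousSubmodule ι K (q + 1) := by
    intro f hf
    have := IsHomogeneous.mul hs hf
    rwa [add_comm] at this
  let mulS : MvPolynomial ι K →ₗ[K] MvPolynomial ι K := LinearMap.mulLeft K s
  let g0 : (gr I (q + 1) × homogeneousSubmodule ι K q) →ₗ[K] MvPolynomial ι K :=
    LinearMap.coprod (gr I (q + 1)).subtype (mulS ∘ₗ (homogeneousSubmodule ι K q).subtype)
  have hg0 : ∀ p, g0 p = p.1.1 + s * p.2.1 := fun p => rfl
  let g := g0.codRestrict (gr (I ⊔ Ideal.span {s}) (q + 1)) (fun p => by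
    rw [hg0]
    exact ⟨Ideal.add_mem _ (Ideal.mem_sup_left p.1.2.1)
      (Ideal.mul_mem_right _ _ (Ideal.mem_sup_right (Ideal.subset_span rfl))),
      Submodule.add_mem _ p.1.2.2 (hsmem _ p.2.2)⟩)
  let f0 : gr I q →ₗ[K] gr I (q + 1) :=
    ((-mulS) ∘ₗ (gr I q).subtype).codRestrict _ (fun p =>
      ⟨Ideal.neg_mem_iff _ |>.2 (Ideal.mul_mem_left _ _ p.2.1),
        Submodule.neg_mem _ (hsmem _ p.2.2)⟩)
  let f := f0.prod (Submodule.inclusion (inf_le_right : gr I q ≤ homogeneousSubmodule ι K q))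
  have hf : ∀ p, (f p).1.1 = -(s * p.1) ∧ (f p).2.1 = p.1 := fun p => ⟨rfl, rfl⟩
  have key := dim_exact f g ?_ ?_ ?_
  · rw [Module.finrank_prod] at key
    have h1 := hilb_add I (q + 1)
    have h2 := hilb_add I q
    have h3 := hilb_add (I ⊔ Ideal.span {s}) (q + 1)
    omega
  · intro a b hab
    have := congrArg (fun z => z.2.1) hab
    exact Subtype.ext this
  · intro p
    constructor
    · intro h
      have h' : p.1.1 + s * p.2.1 = 0 := congrArg Subtype.val h
      have h2 : s * p.2.1 ∈ I := by
        rw [← neg_eq_of_add_eq_zero_right h']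
        exact I.neg_mem p.1.2.1
      refine ⟨⟨p.2.1, hreg _ h2, p.2.2⟩, ?_⟩
      refine Prod.ext (Subtype.ext ?_) (Subtype.ext rfl)
      rw [(hf _).1]
      exact (eq_neg_of_add_eq_zero_left h').symm
    · rintro ⟨x, rfl⟩
      refine Subtype.ext ?_
      change (f x).1.1 + s * (f x).2.1 = 0
      rw [(hf x).1, (hf x).2]; ring
  · rintro ⟨y, hy1, hy2⟩
    obtain ⟨a, ha, b, hb, rfl⟩ := Submodule.mem_sup.1 hy1
    obtain ⟨t, rfl⟩ := Ideal.mem_span_singleton'.1 hb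
    refine ⟨⟨⟨homogeneousComponent (q + 1) a, hI a ha _, homogeneousComponent_mem _ _⟩,
      ⟨homogeneousComponent q t, homogeneousComponent_mem _ _⟩⟩, Subtype.ext ?_⟩
    change homogeneousComponent (q + 1) a + s * homogeneousComponent q t = a + t * s
    rw [← comp_mul hs, ← map_add, mul_comm s t]
    exact homogeneousComponent_eq_self hy2

end Hilb


/-! ### Deletion-restriction for the Hilbert functions -/

section HilbRec

open MvPolynomial

variable {K : Type} [Field K] {W : Type} [AddCommGroup W] [Module K W]

/-- Restriction of a polynomial to the line through `y`. -/
def ep (y : ι → K) : MvPolynomial ι K →ₐ[K] Polynomial K :=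
  aeval (fun i => Polynomial.C (y i) * Polynomial.X)

lemma ep_eval (y : ι → K) (f : MvPolynomial ι K) (t : K) :
    (ep y f).eval t = eval (fun i => y i * t) f := by
  induction f using MvPolynomial.induction_on with
  | C a => simp [ep]
  | add p q hp hq => simp [hp, hq]
  | mul_X p i hp => rw [map_mul, Polynomial.eval_mul, hp]; simp [ep]

lemma ep_monomial (y : ι → K) (m : ι →₀ ℕ) (a : K) :
    ep y (monomial m a) = Polynomial.C (eval y (monomial m a)) * Polynomial.X ^ m.degree := by
  rw [ep, aeval_monomial, eval_monomial]
  simp only [mul_pow, Finsupp.prod, Finset.prod_mul_distrib, Finset.prod_pow_eq_pow_sum,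
    Finsupp.degree, map_mul, map_prod, map_pow, Polynomial.algebraMap_eq]
  rw [mul_assoc]
  rfl

lemma ep_coeff (y : ι → K) (f : MvPolynomial ι K) (q : ℕ) :
    (ep y f).coeff q = eval y (homogeneousComponent q f) := by
  induction f using MvPolynomial.induction_on' with
  | monomial m a =>
    rw [ep_monomial, Polynomial.coeff_C_mul_X_pow,
      homogeneousComponent_of_mem (m := q) (isHomogeneous_monomial a rfl)]
    split_ifs <;> rfl
  | add p r hp hr => rw [map_add, Polynomial.coeff_add, hp, hr, map_add, map_add]

variable {v : ι → W →ₗ[K] K} {E : Finset ι} {X : Submodule K W} {e : ι}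

lemma yv_smul (x : W) (t : K) : yv v E (t⁻¹ • x) = fun i => yv v E x i * t := by
  ext i
  by_cases hi : i ∈ E
  · simp [yv, hi]
  · simp [yv, hi]

lemma UU_smul {x : W} (hx : x ∈ UU v E X) {t : K} (ht : t ≠ 0) : t⁻¹ • x ∈ UU v E X :=
  ⟨X.smul_mem _ hx.1, fun i hi => by simpa [ht] using hx.2 i hi⟩

lemma poly_zero [Infinite K] {p : Polynomial K} (h : ∀ t, t ≠ 0 → p.eval t = 0) : p = 0 := by
  have : Polynomial.X * p = 0 := by
    refine Polynomial.funext fun t => ?_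
    by_cases ht : t = 0
    · simp [ht]
    · simp [h t ht]
  simpa using this

lemma II_hom [Infinite K] : HomI (II v E X) := by
  intro f hf q
  refine mem_II.2 fun x hx => ?_
  have h0 : ep (yv v E x) f = 0 := poly_zero fun t ht => by
    rw [ep_eval, ← yv_smul]
    exact mem_II.1 hf _ (UU_smul hx ht)
  rw [← ep_coeff, h0, Polynomial.coeff_zero]

lemma DD_hom [Infinite K] : HomI (DD v e E X) :=
  II_hom.sup (HomI_span (by
    rintro x rfl
    exact isHomogeneous_X K e))

lemma Rel_comp [Infinite K] {f g : MvPolynomial ι K} (h : Rel v e E X f g) (q : ℕ) :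
    Rel v e E X (homogeneousComponent q f) (homogeneousComponent (q + 1) g) := by
  intro x hx
  have h0 : Polynomial.X * ep (yv v E x) f - Polynomial.C (v e x) * ep (yv v E x) g = 0 :=
    poly_zero fun t ht => by
      rw [Polynomial.eval_sub, Polynomial.eval_mul, Polynomial.eval_mul, ep_eval, ep_eval,
        ← yv_smul, h _ (UU_smul hx ht), Polynomial.eval_X, Polynomial.eval_C, map_smul,
        smul_eq_mul]
      field_simp
      ring
  have h1 := congrArg (fun p => p.coeff (q + 1)) h0
  simp only [Polynomial.coeff_sub, Polynomial.coeff_X_mul, Polynomial.coeff_C_mul,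
    Polynomial.coeff_zero, ep_coeff] at h1
  exact sub_eq_zero.1 h1

lemma gr_rel [Infinite K] (he : e ∉ E) {u : W} (hu : u ∈ X) (hu1 : v e u = 1) (q : ℕ) :
    Module.finrank K (gr (II v E (X ⊓ LinearMap.ker (v e))) q)
      + Module.finrank K (gr (II v E X) (q + 1))
    = Module.finrank K (gr (DD v e E X) (q + 1)) + Module.finrank K (gr (II v E X) q) := by
  set A := II v E X with hA
  set B := II v E (X ⊓ LinearMap.ker (v e)) with hB
  set D := DD v e E X with hD
  let P : Submodule K (gr B q × gr D (q + 1)) :=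
    { carrier := {p | Rel v e E X p.1.1 p.2.1}
      add_mem' := fun ha hb => Rel.add ha hb
      zero_mem' := fun x _ => by simp
      smul_mem' := fun c p hp => by
        have := Rel.mul (C c) hp
        rw [← smul_eq_C_mul, ← smul_eq_C_mul] at this
        exact this }
  let f1 : gr A (q + 1) →ₗ[K] P := LinearMap.codRestrict P
    (LinearMap.prod 0 (Submodule.inclusion (inf_le_inf_right _ (A_le_DD he))))
    (fun p => (Rel_zero_left hu hu1).2 p.2.1)
  let f2 : gr A q →ₗ[K] P := LinearMap.codRestrict P
    (LinearMap.prod (Submodule.inclusion (inf_le_inf_right _ A_le_B)) 0)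
    (fun p => (Rel_zero_right hu hu1).2 p.2.1)
  have k1 := dim_exact (M := P) (N := gr B q) f1
    (LinearMap.fst K (gr B q) (gr D (q + 1)) ∘ₗ P.subtype) ?_ ?_ ?_
  have k2 := dim_exact (M := P) (N := gr D (q + 1)) f2
    (LinearMap.snd K (gr B q) (gr D (q + 1)) ∘ₗ P.subtype) ?_ ?_ ?_
  · omega
  · intro a b hab
    have := congrArg (fun z => z.1.1.1) hab
    exact Subtype.ext this
  · rintro ⟨⟨a, b⟩, hp⟩
    constructor
    · intro h
      have hb : b = 0 := h
      subst hb
      exact ⟨⟨a.1, (Rel_zero_right hu hu1).1 hp, a.2.2⟩, rfl⟩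
    · rintro ⟨y, hy⟩
      rw [← hy]; rfl
  · intro y
    obtain ⟨f, hf, hR⟩ := exists_Rel_of_DD he hu hu1 y.2.1
    have hR' := Rel_comp hR q
    rw [homogeneousComponent_eq_self y.2.2] at hR'
    exact ⟨⟨⟨⟨homogeneousComponent q f, II_hom _ hf _, homogeneousComponent_mem _ _⟩, y⟩, hR'⟩,
      rfl⟩
  · intro a b hab
    have := congrArg (fun z => z.1.2.1) hab
    exact Subtype.ext this
  · rintro ⟨⟨a, b⟩, hp⟩
    constructor
    · intro h
      have hb : a = 0 := h
      subst hb
      exact ⟨⟨b.1, (Rel_zero_left hu hu1).1 hp, b.2.2⟩, rfl⟩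
    · rintro ⟨y, hy⟩
      rw [← hy]; rfl
  · intro y
    obtain ⟨g, hg, hR⟩ := exists_Rel_of_B he hu hu1 y.2.1
    have hR' := Rel_comp hR q
    rw [homogeneousComponent_eq_self y.2.2] at hR'
    exact ⟨⟨⟨y, ⟨homogeneousComponent (q + 1) g, DD_hom _ hg _, homogeneousComponent_mem _ _⟩⟩,
      hR'⟩, rfl⟩

lemma hilb_rec [Infinite K] (he : e ∉ E) {u : W} (hu : u ∈ X) (hu1 : v e u = 1) (q : ℕ) :
    hilb K (II v (insert e E) X) (q + 1) + hilb K (II v E X) q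
      = hilb K (II v (insert e E) X) q + hilb K (II v E X) (q + 1)
        + hilb K (II v E (X ⊓ LinearMap.ker (v e))) q := by
  have h1 := gr_rel he hu hu1 q
  have h2 := hilb_reg (II_hom (v := v) (E := insert e E) (X := X)) (isHomogeneous_X K e)
    (fun f hf => X_reg hf) q
  change _ = _ + hilb K (DD v e E X) (q + 1) at h2
  have h3 := hilb_add (DD v e E X) (q + 1)
  have h4 := hilb_add (II v E X) (q + 1)
  have h5 := hilb_add (II v E X) q
  have h6 := hilb_add (II v E (X ⊓ LinearMap.ker (v e))) q
  omega

end HilbRec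


/-! ### Vanishing of the iterated differences of the Hilbert function -/

section HilbDiff

open MvPolynomial

variable {K : Type} [Field K] {W : Type} [AddCommGroup W] [Module K W]

/-- The Hilbert function with integer values. -/
def hz (I : Ideal (MvPolynomial ι K)) : ℕ → ℤ := fun q => (hilb K I q : ℤ)

lemma hilb_top (q : ℕ) : hilb K (⊤ : Ideal (MvPolynomial ι K)) q = 0 := by
  have h := hilb_add (⊤ : Ideal (MvPolynomial ι K)) q
  have : gr (⊤ : Ideal (MvPolynomial ι K)) q = homogeneousSubmodule ι K q := by
    ext f; simp [mem_gr]
  rw [this] at h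
  omega

lemma hilb_empty [Infinite K] (v : ι → W →ₗ[K] K) (X : Submodule K W) (q : ℕ) :
    hilb K (II v ∅ X) (q + 1) = 0 := by
  have h := hilb_add (II v ∅ X) (q + 1)
  have : gr (II v ∅ X) (q + 1) = homogeneousSubmodule ι K (q + 1) := by
    refine le_antisymm inf_le_right fun f hf => ⟨?_, hf⟩
    refine mem_II.2 fun x hx => ?_
    have hy : yv v ∅ x = 0 := by ext i; simp [yv]
    have h2 := ep_coeff (0 : ι → K) f (q + 1)
    rw [homogeneousComponent_eq_self hf] at h2
    rw [hy, ← h2]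
    have h3 : ∀ f : MvPolynomial ι K, ep (0 : ι → K) f = Polynomial.C (eval 0 f) := by
      intro f
      induction f using MvPolynomial.induction_on with
      | C a => simp [ep]
      | add p r hp hr => rw [map_add, hp, hr, map_add, map_add]
      | mul_X p i hp => simp [ep]
    rw [h3, Polynomial.coeff_C_succ]
  rw [this] at h
  omega

variable [FiniteDimensional K W]

theorem diff_zero [Infinite K] (v : ι → W →ₗ[K] K) (E : Finset ι) :
    ∀ X : Submodule K W, Spans v E X →
      (∀ r, Module.finrank K X = r + 1 → (fwdDiff 1)^[r + 1] (hz (II v E X)) = 0) ∧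
      (Module.finrank K X = 0 → (∀ q, hilb K (II v E X) (q + 1) = 0) ∧
        (E.Nonempty → ∀ q, hilb K (II v E X) q = 0)) := by
  induction E using Finset.induction_on with
  | empty =>
    intro X hX
    have : X = ⊥ := (Submodule.eq_bot_iff _).2 fun x hx => hX x hx (by simp)
    subst this
    refine ⟨fun r hr => ?_, fun _ => ⟨hilb_empty v _, fun h => by simp at h⟩⟩
    rw [finrank_bot] at hr
    omega
  | insert e E he ih =>
    intro X hX
    by_cases h0 : ∀ x ∈ X, v e x = 0
    · rw [II_eq_top (Finset.mem_insert_self e E) h0]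
      have hz0 : hz (⊤ : Ideal (MvPolynomial ι K)) = 0 := by
        ext q; simp [hz, hilb_top]
      refine ⟨fun r _ => ?_, fun _ => ⟨fun q => hilb_top _, fun _ q => hilb_top _⟩⟩
      rw [hz0]
      have : ∀ n, (fwdDiff 1)^[n] (0 : ℕ → ℤ) = 0 := fun n => by
        exact Function.iterate_fixed (by ext q; simp [fwdDiff]) n
      exact this _
    obtain ⟨u, hu, hu1⟩ := exists_u h0
    have hr := finrank_H hu hu1
    refine ⟨fun r hr' => ?_, fun h => by omega⟩
    have hr1 : Module.finrank K (X ⊓ LinearMap.ker (v e) : Submodule K W) = r := by omega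
    have hΔ : fwdDiff 1 (hz (II v (insert e E) X)) = fwdDiff 1 (hz (II v E X))
        + hz (II v E (X ⊓ LinearMap.ker (v e))) := by
      ext q
      have := hilb_rec he hu hu1 q
      simp only [fwdDiff, hz, Pi.add_apply]
      zify at this
      linarith
    obtain ⟨ihB1, ihB0⟩ := ih _ hX.restrict
    by_cases hE : Spans v E X
    · rw [Function.iterate_succ_apply, hΔ, fwdDiff_iter_add, ← Function.iterate_succ_apply,
        (ih X hE).1 r hr', zero_add]
      rcases r with _ | r
      · have hne : E.Nonempty := by
          by_contra hne
          rw [Finset.not_nonempty_iff_eq_empty] at hne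
          have := hE u hu (by simp [hne])
          rw [this] at hu1
          simp at hu1
        ext q
        simp [hz, (ihB0 hr1).2 hne q]
      · exact ihB1 r hr1
    · obtain ⟨u', hu', h1, h2⟩ := hX.coloop hE
      have hAB : II v E X = II v E (X ⊓ LinearMap.ker (v e)) :=
        le_antisymm A_le_B (B_le_A hu' h1 h2)
      rw [Function.iterate_succ_apply, hΔ, hAB]
      rcases r with _ | r
      · ext q
        simp [hz, fwdDiff, (ihB0 hr1).1 q]
      · rw [fwdDiff_iter_add, ← Function.iterate_succ_apply, Function.iterate_succ_apply',
          ihB1 r hr1, add_zero]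
        ext q; simp [fwdDiff]

end HilbDiff


/-! ### Homogeneous associated primes and the irrelevant ideal -/

section HomPrimes

open MvPolynomial

attribute [local instance] MvPolynomial.gradedAlgebra

variable {K : Type} [Field K]

/-- The irrelevant maximal ideal. -/
def mm (ι K : Type) [Field K] : Ideal (MvPolynomial ι K) :=
  RingHom.ker (constantCoeff : MvPolynomial ι K →+* K)

lemma mm_max : (mm ι K).IsMaximal :=
  RingHom.ker_isMaximal_of_surjective _ (fun a => ⟨C a, by simp⟩)

lemma mem_mm {f : MvPolynomial ι K} : f ∈ mm ι K ↔ constantCoeff f = 0 := Iff.rfl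

lemma X_mem_mm (i : ι) : (X i : MvPolynomial ι K) ∈ mm ι K := by simp [mem_mm]

lemma mm_le {I : Ideal (MvPolynomial ι K)} (h : ∀ i, X i ∈ I) : mm ι K ≤ I := by
  have key : ∀ f : MvPolynomial ι K, f - C (constantCoeff f) ∈ I := by
    intro f
    induction f using MvPolynomial.induction_on with
    | C a => simp
    | add p q hp hq =>
      have := I.add_mem hp hq
      rw [map_add, map_add]
      convert this using 1
      ring
    | mul_X p i hp =>
      simp only [map_mul, constantCoeff_X, mul_zero, map_zero, sub_zero]
      exact I.mul_mem_left _ (h i)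
  intro f hf
  have := key f
  rwa [mem_mm.1 hf, map_zero, sub_zero] at this

lemma mm_le' {I : Ideal (MvPolynomial ι K)}
    (h : homogeneousSubmodule ι K 1 ≤ I.restrictScalars K) : mm ι K ≤ I :=
  mm_le fun i => h (isHomogeneous_X K i)

lemma le_mm {I : Ideal (MvPolynomial ι K)} (hI : HomI I) (h : I ≠ ⊤) : I ≤ mm ι K := by
  intro f hf
  by_contra hc
  refine h ((Ideal.eq_top_iff_one _).2 ?_)
  have h0 := hI f hf 0
  rw [homogeneousComponent_zero] at h0
  have h1 := I.mul_mem_left (C (constantCoeff f)⁻¹) h0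
  rw [← C_mul] at h1
  have : (constantCoeff f)⁻¹ * coeff 0 f = 1 := by
    rw [← constantCoeff_eq]
    exact inv_mul_cancel₀ hc
  rwa [this, C_1] at h1

lemma comp_mul' {g : MvPolynomial ι K} {q : ℕ} (hg : g ∈ homogeneousSubmodule ι K q)
    (f : MvPolynomial ι K) (k : ℕ) :
    homogeneousComponent (k + q) (f * g) = homogeneousComponent k f * g := by
  have := DirectSum.coe_decompose_mul_add_of_right_mem (homogeneousSubmodule ι K) (i := k) (j := q)
    (a := f) hg
  rwa [← DirectSum.Decomposition.decompose'_eq, decomposition.decompose'_apply,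
    decomposition.decompose'_apply] at this

/-- The annihilator of the class of `g` modulo `J`. -/
def an (J : Ideal (MvPolynomial ι K)) (g : MvPolynomial ι K) : Ideal (MvPolynomial ι K) where
  carrier := {a | a * g ∈ J}
  add_mem' := fun {a b} ha hb => by
    simp only [Set.mem_ofPred_eq, add_mul] at *
    exact J.add_mem ha hb
  zero_mem' := by simp
  smul_mem' := fun c a ha => by
    simp only [Set.mem_ofPred_eq, smul_eq_mul, mul_assoc] at *
    exact J.mul_mem_left _ ha

lemma mem_an {J : Ideal (MvPolynomial ι K)} {g a : MvPolynomial ι K} :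
    a ∈ an J g ↔ a * g ∈ J := Iff.rfl

lemma an_hom {J : Ideal (MvPolynomial ι K)} (hJ : HomI J) {g : MvPolynomial ι K} {q : ℕ}
    (hg : g ∈ homogeneousSubmodule ι K q) : HomI (an J g) := by
  intro f hf k
  rw [mem_an, ← comp_mul' hg]
  exact hJ _ hf _

/-- Primes which are annihilators of homogeneous elements. -/
def HPr (J : Ideal (MvPolynomial ι K)) : Set (Ideal (MvPolynomial ι K)) :=
  {p | p.IsPrime ∧ ∃ q, ∃ g ∈ homogeneousSubmodule ι K q, p = an J g}

lemma HPr_finite (J : Ideal (MvPolynomial ι K)) : (HPr J).Finite := by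
  refine (associatedPrimes.finite (MvPolynomial ι K) (MvPolynomial ι K ⧸ J)).subset ?_
  rintro p ⟨hp, q, g, -, rfl⟩
  refine Submodule.isAssociatedPrime_iff.2 ⟨hp, Ideal.Quotient.mk J g, ?_⟩
  ext a
  rw [mem_an, Submodule.mem_colon_singleton, Submodule.mem_bot, ← Ideal.Quotient.eq_zero_iff_mem]
  rfl

lemma exists_HPr {J : Ideal (MvPolynomial ι K)} (hJ : HomI J) {w f : MvPolynomial ι K}
    (hw : w ∈ homogeneousSubmodule ι K 1) (hf : f ∉ J) (hwf : w * f ∈ J) : ∃ p ∈ HPr J, w ∈ p := by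
  let A : Set (Ideal (MvPolynomial ι K)) :=
    {I | w ∈ I ∧ ∃ q, ∃ g ∈ homogeneousSubmodule ι K q, g ∉ J ∧ I = an J g}
  have hne : A.Nonempty := by
    obtain ⟨q, hq⟩ : ∃ q, homogeneousComponent q f ∉ J := by
      by_contra! hc
      apply hf
      rw [← sum_homogeneousComponent f]
      exact J.sum_mem fun i _ => hc i
    refine ⟨_, ?_, q, _, homogeneousComponent_mem q f, hq, rfl⟩
    rw [mem_an, ← comp_mul hw]
    exact hJ _ hwf _
  obtain ⟨p, ⟨hwp, q, g, hg, hgJ, rfl⟩, hmax⟩ :=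
    set_has_maximal_iff_noetherian.2 (inferInstance : IsNoetherian (MvPolynomial ι K) _) A hne
  refine ⟨_, ⟨?_, q, g, hg, rfl⟩, hwp⟩
  refine (HomI_iff.1 (an_hom hJ hg)).isPrime_of_homogeneous_mem_or_mem ?_ ?_
  · intro h
    apply hgJ
    have := (Ideal.eq_top_iff_one _).1 h
    rwa [mem_an, one_mul] at this
  · rintro x y hx ⟨k, hy⟩ hxy
    by_cases hyg : y * g ∈ J
    · exact Or.inr hyg
    left
    have hle : an J g ≤ an J (y * g) := by
      intro a ha
      rw [mem_an] at ha ⊢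
      rw [mul_left_comm]
      exact J.mul_mem_left _ ha
    have hA : an J (y * g) ∈ A :=
      ⟨hle hwp, k + q, y * g, IsHomogeneous.mul hy hg, hyg, rfl⟩
    have heq : an J g = an J (y * g) := by
      by_contra hc
      exact hmax _ hA (lt_of_le_of_ne hle hc)
    rw [heq, mem_an, ← mul_assoc]
    exact hxy

lemma avoid [Infinite K] {s : Set (Ideal (MvPolynomial ι K))} (hs : s.Finite)
    (V : Submodule K (MvPolynomial ι K)) (h : ∀ p ∈ s, ¬ V ≤ p.restrictScalars K) :
    ∃ w ∈ V, ∀ p ∈ s, w ∉ p := by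
  classical
  let t : Finset (Submodule K V) :=
    hs.toFinset.image fun p => Submodule.comap V.subtype (p.restrictScalars K)
  have ht : (⊤ : Submodule K V) ∉ t := by
    intro hc
    obtain ⟨p, hp, hpt⟩ := Finset.mem_image.1 hc
    refine h p (by simpa using hp) fun x hx => ?_
    have : (⟨x, hx⟩ : V) ∈ Submodule.comap V.subtype (p.restrictScalars K) := by
      rw [hpt]; trivial
    exact this
  have := Subspace.biUnion_ne_univ_of_top_notMem ht
  obtain ⟨w, hw⟩ := (Set.ne_univ_iff_exists_notMem _).1 this
  refine ⟨w, w.2, fun p hp hc => hw ?_⟩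
  simp only [Set.mem_iUnion]
  exact ⟨_, Finset.mem_image.2 ⟨p, by simpa using hp, rfl⟩, hc⟩

end HomPrimes


/-! ### Linear sections of Cohen-Macaulay graded rings -/

section Sections

open MvPolynomial

attribute [local instance] MvPolynomial.gradedAlgebra

variable {K : Type} [Field K]

lemma lin_mem_mm {w : MvPolynomial ι K} (hw : w ∈ homogeneousSubmodule ι K 1) : w ∈ mm ι K := by
  have h := homogeneousComponent_of_mem (m := 0) hw
  rw [homogeneousComponent_zero, if_neg (by norm_num)] at h
  rw [mem_mm, constantCoeff_eq]
  simpa using h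

/-- No chain of three primes above `T`. -/
def DimLe (T : Ideal (MvPolynomial ι K)) : Prop :=
  ∀ p0 p1 p2 : Ideal (MvPolynomial ι K), p0.IsPrime → p1.IsPrime → p2.IsPrime → T ≤ p0 →
    p0 < p1 → p1 < p2 → False

lemma HPr_hom {J p : Ideal (MvPolynomial ι K)} (hJ : HomI J) (hp : p ∈ HPr J) : HomI p := by
  obtain ⟨-, q, g, hg, rfl⟩ := hp
  exact an_hom hJ hg

lemma HPr_le {J p : Ideal (MvPolynomial ι K)} (hp : p ∈ HPr J) : J ≤ p := by
  obtain ⟨-, q, g, hg, rfl⟩ := hp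
  exact fun a ha => J.mul_mem_right _ ha

lemma HPr_not {J p : Ideal (MvPolynomial ι K)} (hd : Dep (mm ι K) 1 (MvPolynomial ι K ⧸ J))
    (hp : p ∈ HPr J) : ¬ mm ι K ≤ p := by
  obtain ⟨hp, q, g, hg, rfl⟩ := hp
  intro h
  have h0 : (Submodule.Quotient.mk g : MvPolynomial ι K ⧸ J) = 0 := by
    refine Dep.eq_zero (k := 0) hd fun r hr => ?_
    exact (Submodule.Quotient.mk_eq_zero _).2 (h hr)
  have h1 : g ∈ J := (Submodule.Quotient.mk_eq_zero _).1 h0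
  exact hp.ne_top ((Ideal.eq_top_iff_one _).2 (by rwa [mem_an, one_mul]))

lemma exists_reg [Infinite K] {J : Ideal (MvPolynomial ι K)} (hJ : HomI J)
    {V : Submodule K (MvPolynomial ι K)} (hV : V ≤ homogeneousSubmodule ι K 1)
    (h : ∀ p ∈ HPr J, ¬ V ≤ p.restrictScalars K) :
    ∃ w ∈ V, (∀ p ∈ HPr J, w ∉ p) ∧ ∀ f, w * f ∈ J → f ∈ J := by
  obtain ⟨w, hw, hp⟩ := avoid (HPr_finite J) V h
  refine ⟨w, hw, hp, fun f hf => ?_⟩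
  by_contra hc
  obtain ⟨p, hp1, hp2⟩ := exists_HPr hJ (hV hw) hc hf
  exact hp p hp1 hp2

lemma dep_sup {J : Ideal (MvPolynomial ι K)} {w : MvPolynomial ι K} {m : Ideal (MvPolynomial ι K)}
    (hreg : ∀ f, w * f ∈ J → f ∈ J) {k : ℕ} (hd : Dep m (k + 1) (MvPolynomial ι K ⧸ J)) :
    Dep m k (MvPolynomial ι K ⧸ (J ⊔ Ideal.span {w})) :=
  Dep.quot_smul (lsmul_inj hreg) (lsmul_exact (le_sup_left) rfl) (factor_surj _) hd

lemma not_le_HPr [Infinite K] {J T : Ideal (MvPolynomial ι K)} (hJ : HomI J)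
    (hd : Dep (mm ι K) 2 (MvPolynomial ι K ⧸ J)) (hT : DimLe T) :
    ∀ p ∈ HPr J, ¬ T ≤ p := by
  intro p hp hTp
  obtain ⟨v, hv, hvp, hreg⟩ := exists_reg hJ le_rfl
    fun p hp h => HPr_not (hd.mono (by norm_num)) hp (mm_le' h)
  have hpm : p ≤ mm ι K := le_mm (HPr_hom hJ hp) hp.1.ne_top
  have hhom : HomI (p ⊔ Ideal.span {v}) :=
    (HPr_hom hJ hp).sup (HomI_span (by simpa using hv))
  have hrad : mm ι K ≤ (p ⊔ Ideal.span {v}).radical := by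
    rw [(HomI_iff.1 hhom).radical_eq]
    refine le_sInf ?_
    rintro Q ⟨hQ1, hQ2, hQ3⟩
    have hlt : p < Q := by
      refine lt_of_le_of_ne (le_sup_left.trans hQ2) ?_
      rintro rfl
      exact hvp _ hp (hQ2 (Ideal.mem_sup_right (Ideal.mem_span_singleton_self v)))
    have hQm : Q ≤ mm ι K := le_mm (HomI_iff.2 hQ1) hQ3.ne_top
    by_contra hc
    exact hT p Q (mm ι K) hp.1 hQ3 mm_max.isPrime hTp hlt (lt_of_le_not_ge hQm hc)
  obtain ⟨s, hs⟩ := Ideal.exists_pow_le_of_le_radical_of_fg_radical hrad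
    (IsNoetherian.noetherian _)
  classical
  have hex := hp.2
  obtain ⟨g, hg, hpg⟩ := Nat.find_spec hex
  have hmin := fun k (hk : k < Nat.find hex) => Nat.find_min hex hk
  generalize Nat.find hex = q at *
  have hgJ : g ∉ J := by
    intro h1
    refine hp.1.ne_top ((Ideal.eq_top_iff_one _).2 ?_)
    rwa [hpg, mem_an, one_mul]
  have hnot : g ∉ J ⊔ Ideal.span {v} := by
    intro hc
    obtain ⟨j, hj, y, hy, hjy⟩ := Submodule.mem_sup.1 hc
    obtain ⟨h, rfl⟩ := Ideal.mem_span_singleton'.1 hy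
    rw [mul_comm] at hjy
    have hgq := homogeneousComponent_eq_self hg
    rw [← hjy, map_add] at hgq
    cases q with
    | zero =>
      have h0 : homogeneousComponent 0 (v * h) = 0 := by
        have : v * h ∈ mm ι K := Ideal.mul_mem_right _ _ (lin_mem_mm hv)
        rw [mem_mm, constantCoeff_eq] at this
        rw [homogeneousComponent_zero, this, map_zero]
      rw [h0, add_zero, hjy] at hgq
      apply hgJ
      rw [← hgq]
      exact hJ _ hj _
    | succ q =>
      rw [comp_mul hv, hjy] at hgq
      refine hmin q (by omega) ⟨homogeneousComponent q h, homogeneousComponent_mem q h, ?_⟩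
      rw [hpg]
      ext a
      rw [mem_an, mem_an, ← hgq, mul_add]
      have h1 : a * homogeneousComponent (q + 1) j ∈ J := J.mul_mem_left _ (hJ _ hj _)
      rw [J.add_mem_iff_right h1, mul_left_comm]
      exact ⟨fun h => hreg _ h, fun h => J.mul_mem_left _ h⟩
  apply hnot
  refine (Submodule.Quotient.mk_eq_zero _).1 ?_
  refine Dep.eq_zero_pow (k := 0) (dep_sup hreg hd) s fun r hr => ?_
  refine (Submodule.Quotient.mk_eq_zero _).2 ?_
  change r * g ∈ _
  obtain ⟨j, hj, y, hy, hjy⟩ := Submodule.mem_sup.1 (hs hr)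
  rw [← hjy, add_mul]
  refine Ideal.add_mem _ (Ideal.mem_sup_left ?_) (Ideal.mem_sup_right (Ideal.mul_mem_right _ _ hy))
  rwa [hpg] at hj

theorem section_claim [Infinite K] {T : Ideal (MvPolynomial ι K)} (hTtop : T ≠ ⊤)
    (hT : DimLe T) (m : ℕ) : ∀ (J : Ideal (MvPolynomial ι K))
    (V : Submodule K (MvPolynomial ι K)), HomI J → V ≤ homogeneousSubmodule ι K 1 →
    Module.finrank K V = m → Dep (mm ι K) (m + 1) (MvPolynomial ι K ⧸ J) →
    T = J ⊔ Ideal.span (V : Set (MvPolynomial ι K)) →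
    ∀ q, hz T (q + m) = (fwdDiff 1)^[m] (hz J) q := by
  induction m with
  | zero =>
    intro J V hJ hV hm hd hTJ q
    have : FiniteDimensional K V := Submodule.finiteDimensional_of_le hV
    have : V = ⊥ := Submodule.finrank_eq_zero.1 hm
    subst this
    have : T = J := by
      rw [hTJ]
      simp
    simp [this]
  | succ m ih =>
    intro J V hJ hV hm hd hTJ q
    have hfd : FiniteDimensional K V := Submodule.finiteDimensional_of_le hV
    have hnot : ∀ p ∈ HPr J, ¬ V ≤ p.restrictScalars K := by
      intro p hp hVp
      refine not_le_HPr hJ (hd.mono (by omega)) hT p hp ?_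
      rw [hTJ]
      exact sup_le (HPr_le hp) (Ideal.span_le.2 hVp)
    obtain ⟨w, hw, -, hreg⟩ := exists_reg hJ hV hnot
    have hw0 : w ≠ 0 := by
      rintro rfl
      apply hTtop
      rw [hTJ, (Ideal.eq_top_iff_one J).2 (hreg 1 (by simp)), top_sup_eq]
    have hwV : Submodule.span K {w} ≤ V := by simpa using hw
    obtain ⟨C, hC⟩ := Submodule.exists_isCompl (Submodule.span K {w})
    have hsup : Submodule.span K {w} ⊔ (V ⊓ C) = V := by
      rw [inf_comm, ← sup_inf_assoc_of_le C hwV, hC.sup_eq_top, top_inf_eq]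
    have hinf : Submodule.span K {w} ⊓ (V ⊓ C) = ⊥ := by
      rw [inf_left_comm, hC.inf_eq_bot, inf_bot_eq]
    have hfd2 : FiniteDimensional K (V ⊓ C : Submodule K _) :=
      Submodule.finiteDimensional_of_le inf_le_left
    have hfr := Submodule.finrank_sup_add_finrank_inf_eq (Submodule.span K {w}) (V ⊓ C)
    rw [hsup, hinf, finrank_bot, finrank_span_singleton hw0, hm] at hfr
    have hws : HomI (Ideal.span {w}) := HomI_span (by simpa using hV hw)
    have h1 := ih (J ⊔ Ideal.span {w}) (V ⊓ C) (hJ.sup hws) (inf_le_left.trans hV) (by omega)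
      (dep_sup hreg hd) (by
        rw [hTJ, sup_assoc]
        congr 1
        refine le_antisymm (Ideal.span_le.2 fun x hx => ?_) (sup_le ?_ ?_)
        · have hx' : x ∈ V := hx
          rw [← hsup] at hx'
          obtain ⟨y, hy, z, hz, rfl⟩ := Submodule.mem_sup.1 hx'
          refine Ideal.add_mem _ (Ideal.mem_sup_left ?_) (Ideal.mem_sup_right (Ideal.subset_span hz))
          obtain ⟨a, rfl⟩ := Submodule.mem_span_singleton.1 hy
          rw [MvPolynomial.smul_eq_C_mul]
          exact Ideal.mul_mem_left _ _ (Ideal.mem_span_singleton_self w)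
        · exact Ideal.span_mono (by simpa using hw)
        · exact Ideal.span_mono inf_le_left)
    have h2 : (fun q => hz (J ⊔ Ideal.span {w}) (q + 1)) = fwdDiff 1 (hz J) := by
      funext q
      have := hilb_reg hJ (hV hw) hreg q
      simp only [fwdDiff, hz]
      rw [this]
      push_cast
      ring
    have h3 := h1 (q + 1)
    rw [show q + (m + 1) = q + 1 + m by ring, h3, Function.iterate_succ_apply, ← h2,
      ← fwdDiff_iter_comp_add]

end Sections


/-! ### Dimension descent and identification of the reciprocal space -/

section Descent

open MvPolynomial

variable {K : Type} [Field K]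

attribute [local instance] MvPolynomial.algebraMvPolynomial in
lemma dimLe_of_krull {T : Ideal (MvPolynomial ι K)}
    (h : ringKrullDim (MvPolynomial ι (AlgebraicClosure K) ⧸
        Ideal.map (MvPolynomial.map (algebraMap K (AlgebraicClosure K))) T) = 1) :
    DimLe T ∧ T ≠ ⊤ := by
  constructor
  · intro p0 p1 p2 h0 h1 h2 hT h01 h12
    have hker : (⊥ : Ideal (MvPolynomial ι (AlgebraicClosure K))).comap
        (algebraMap (MvPolynomial ι K) (MvPolynomial ι (AlgebraicClosure K))) ≤ p0 := by
      intro f hf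
      have hf' : MvPolynomial.map (algebraMap K (AlgebraicClosure K)) f = 0 := hf
      have : f = 0 := MvPolynomial.map_injective _ (algebraMap K (AlgebraicClosure K)).injective
        (by rw [hf', map_zero])
      rw [this]; exact p0.zero_mem
    obtain ⟨P0, -, hP0, e0⟩ := Ideal.exists_ideal_over_prime_of_isIntegral p0 _ hker
    obtain ⟨P1, l1, hP1, e1⟩ := Ideal.exists_ideal_over_prime_of_isIntegral p1 P0
      (e0.le.trans h01.le)
    obtain ⟨P2, l2, hP2, e2⟩ := Ideal.exists_ideal_over_prime_of_isIntegral p2 P1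
      (e1.le.trans h12.le)
    have hT0 : Ideal.map (MvPolynomial.map (algebraMap K (AlgebraicClosure K))) T ≤ P0 := by
      rw [Ideal.map_le_iff_le_comap]
      exact hT.trans e0.ge
    have k01 : P0 < P1 := lt_of_le_of_ne l1 (by rintro rfl; exact h01.ne (e0.symm.trans e1))
    have k12 : P1 < P2 := lt_of_le_of_ne l2 (by rintro rfl; exact h12.ne (e1.symm.trans e2))
    rw [ringKrullDim_quotient] at h
    have := Order.krullDim_le_one_iff.1 h.le
      ⟨⟨P1, hP1⟩, (PrimeSpectrum.mem_zeroLocus _ _).2 (hT0.trans l1)⟩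
    rcases this with hm | hm
    · have := hm (b := ⟨⟨P0, hP0⟩, (PrimeSpectrum.mem_zeroLocus _ _).2 hT0⟩) l1
      exact absurd this (not_le_of_gt k01)
    · have := hm (b := ⟨⟨P2, hP2⟩, (PrimeSpectrum.mem_zeroLocus _ _).2
        ((hT0.trans l1).trans l2)⟩) l2
      exact absurd this (not_le_of_gt k12)
  · rintro rfl
    rw [Ideal.map_top] at h
    have := (Ideal.Quotient.subsingleton_iff (I := (⊤ : Ideal (MvPolynomial ι (AlgebraicClosure K))))).2 rfl
    rw [ringKrullDim_eq_bot_of_subsingleton] at h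
    exact absurd h (by simp)

/-- The linear forms given by the columns of a matrix. -/
def colv (L : Matrix (Fin (d + 1)) ι K) (i : ι) : (Fin (d + 1) → K) →ₗ[K] K :=
  (LinearMap.proj i).comp L.vecMulLinear

lemma colv_apply (L : Matrix (Fin (d + 1)) ι K) (i : ι) (z : Fin (d + 1) → K) :
    colv L i z = z 0 * L 0 i + ∑ j : Fin d, z j.succ * L j.succ i := by
  rw [← Fin.sum_univ_succ (fun r => z r * L r i)]
  rfl

lemma ell_eq (L : Matrix (Fin (d + 1)) ι K) (i : ι) (x : Fin d → K) :
    ell K L x i = colv L i (Fin.cons 1 x) := by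
  rw [colv_apply]
  simp [ell]

lemma spans_of_rank (L : Matrix (Fin (d + 1)) ι K) (h : L.rank = d + 1) :
    Spans (colv L) Finset.univ ⊤ := by
  have hli : LinearIndependent K L.row := by
    rw [linearIndependent_iff_card_eq_finrank_span, Set.finrank, ← Matrix.rank_eq_finrank_span_row,
      h]
    simp
  have hinj := Matrix.vecMul_injective_iff.2 hli
  intro x _ hx
  refine hinj ?_
  ext i
  simpa [colv] using hx i (Finset.mem_univ i)

lemma yv_colv (L : Matrix (Fin (d + 1)) ι K) (x : Fin d → K) :
    yv (colv L) Finset.univ (Fin.cons 1 x : Fin (d + 1) → K) = fun i => (ell K L x i)⁻¹ := by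
  ext i
  simp [yv, ell_eq]

lemma mem_UU_colv (L : Matrix (Fin (d + 1)) ι K) {x : Fin d → K} (hx : x ∈ complementK K L) :
    (Fin.cons 1 x : Fin (d + 1) → K) ∈ UU (colv L) Finset.univ ⊤ :=
  ⟨trivial, fun i _ => by rw [← ell_eq]; exact hx i⟩

lemma cone_eval (L : Matrix (Fin (d + 1)) ι K) {f : MvPolynomial ι K}
    (hf : f ∈ vanishingIdeal K (coneImageK K L)) {z : Fin (d + 1) → K}
    (hz : z ∈ UU (colv L) Finset.univ ⊤) (h0 : z 0 ≠ 0) :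
    eval (yv (colv L) Finset.univ z) f = 0 := by
  have hz' : z = z 0 • (Fin.cons 1 (fun j => (z 0)⁻¹ * z j.succ) : Fin (d + 1) → K) := by
    ext i
    refine Fin.cases ?_ (fun j => ?_) i
    · simp
    · simp [h0]
  have hy := yv_smul (v := colv L) (E := Finset.univ)
    (Fin.cons 1 (fun j => (z 0)⁻¹ * z j.succ) : Fin (d + 1) → K) (z 0)⁻¹
  rw [inv_inv, ← hz', yv_colv] at hy
  refine hf _ ⟨(z 0)⁻¹, fun j => (z 0)⁻¹ * z j.succ, fun i hi => ?_, ?_⟩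
  · have := hz.2 i (Finset.mem_univ i)
    rw [hz', map_smul, ← ell_eq, hi, smul_zero] at this
    exact this rfl
  · rw [hy]
    ext i
    rw [div_eq_inv_mul]

lemma cone_eq [Infinite K] (L : Matrix (Fin (d + 1)) ι K) :
    vanishingIdeal K (coneImageK K L) = II (colv L) Finset.univ ⊤ := by
  apply le_antisymm
  · intro f hf
    refine mem_II.2 fun z hz => ?_
    by_cases h0 : z 0 = 0
    · let u : Fin (d + 1) → K := Fin.cons 1 0
      have := IsRat.zero (isRat_eval (colv L) Finset.univ z u f)
        (lineD_ne.2 (by simpa using hz.2)) (p := Polynomial.X) Polynomial.X_ne_zero (by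
          intro t ht hp
          refine cone_eval L hf ⟨trivial, lineD_ne.1 ht⟩ ?_
          simpa [h0, u] using hp)
      simpa using this
    · exact cone_eval L hf hz h0
  · intro f hf
    rintro _ ⟨c, x, hx, rfl⟩
    by_cases hc : c = 0
    · have hne : II (colv L) Finset.univ ⊤ ≠ ⊤ := by
        intro h
        have := mem_II.1 ((Ideal.eq_top_iff_one _).1 h) _ (mem_UU_colv L hx)
        simp at this
      have := mem_mm.1 (le_mm II_hom hne hf)
      rw [hc]
      simp only [zero_div]
      rw [← Pi.zero_def, MvPolynomial.eval_zero]
      exact this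
    · have h := mem_II.1 hf _ (UU_smul (mem_UU_colv L hx) hc)
      rw [yv_smul, yv_colv] at h
      convert h using 2
      congr 1
      ext i
      rw [div_eq_inv_mul]

end Descent


/-! ### The final argument -/

section Final

open MvPolynomial

lemma poly_diff {P : Polynomial ℚ} {g : ℕ → ℤ} {N m k : ℕ}
    (hP : ∀ q : ℕ, N ≤ q → P.eval (q : ℚ) = (g q : ℚ)) (hdeg : P.degree = (m : ℕ))
    (hlead : P.leadingCoeff = (k : ℚ) / (m.factorial : ℚ)) :
    (fwdDiff 1)^[m] g N = (k : ℤ) := by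
  have hnat : P.natDegree = m := Polynomial.natDegree_eq_of_degree_eq_some hdeg
  have h := congrFun (Polynomial.fwdDiff_iter_degree_eq_factorial P) (N : ℚ)
  rw [hnat, hlead, fwdDiff_iter_eq_sum_shift] at h
  have h2 : (((fwdDiff 1)^[m] g N : ℤ) : ℚ) = (k : ℚ) := by
    rw [fwdDiff_iter_eq_sum_shift]
    have hf : (m.factorial : ℚ) ≠ 0 := by exact_mod_cast m.factorial_ne_zero
    have h3 : ((k : ℚ) / (m.factorial : ℚ)) * (m.factorial : ℚ) = k := div_mul_cancel₀ _ hf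
    rw [← h3]
    refine Eq.trans ?_ (h.trans (by simp))
    push_cast
    refine Finset.sum_congr rfl fun j _ => ?_
    have := hP (N + j) (by omega)
    push_cast at this
    simp [this]
  exact_mod_cast h2

theorem final_aux {d n : ℕ} (K : Type) [Field K] [CharZero K]
    (L : Matrix (Fin (d+1)) (Fin (n+1)) K) (hrank : L.rank = d + 1)
    (lin : Fin d → MvPolynomial (Fin (n+1)) K)
    (hhom : ∀ j, lin j ∈ MvPolynomial.homogeneousSubmodule (Fin (n+1)) K 1)
    (hindep : LinearIndependent K lin)
    (hdim : ringKrullDim (MvPolynomial (Fin (n+1)) (AlgebraicClosure K) ⧸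
        Ideal.map (MvPolynomial.map (algebraMap K (AlgebraicClosure K)))
          (vanishingIdeal K (coneImageK K L) ⊔ Ideal.span (Set.range lin))) = 1) :
    HReg K (vanishingIdeal K (coneImageK K L) ⊔ Ideal.span (Set.range lin)) ≤ d ∧
    ∀ k : ℕ, IsProjDegree K (vanishingIdeal K (coneImageK K L)) d k →
      ∀ q : ℕ, d ≤ q →
        hilb K (vanishingIdeal K (coneImageK K L) ⊔ Ideal.span (Set.range lin)) q = k := by
  have : Infinite K := inferInstance
  obtain ⟨hT, hTtop⟩ := dimLe_of_krull hdim
  have hspans := spans_of_rank L hrank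
  have hfr : Module.finrank K (⊤ : Submodule K (Fin (d + 1) → K)) = d + 1 := by simp
  have hdep := dep_II (colv L) (m := mm (Fin (n + 1)) K) X_mem_mm Finset.univ ⊤ hspans
  have hdiff := (diff_zero (colv L) Finset.univ ⊤ hspans).1 d hfr
  rw [hfr] at hdep
  have hI : HomI (II (colv L) Finset.univ ⊤) := II_hom
  rw [← cone_eq L] at hdep hdiff hI
  generalize vanishingIdeal K (coneImageK K L) = I at *
  have hspan : Ideal.span (Set.range lin) =
      Ideal.span ((Submodule.span K (Set.range lin) : Submodule K _) :
        Set (MvPolynomial (Fin (n+1)) K)) := by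
    refine le_antisymm (Ideal.span_mono Submodule.subset_span) (Ideal.span_le.2 ?_)
    have : Submodule.span K (Set.range lin) ≤
        (Ideal.span (Set.range lin)).restrictScalars K :=
      Submodule.span_le.2 Ideal.subset_span
    exact this
  have key := section_claim hTtop hT d I (Submodule.span K (Set.range lin)) hI
    (Submodule.span_le.2 (by rintro _ ⟨j, rfl⟩; exact hhom j))
    (by rw [finrank_span_eq_card hindep]; simp) hdep (by rw [hspan])
  have hconst : ∀ q, (fwdDiff 1)^[d] (hz I) q = (fwdDiff 1)^[d] (hz I) 0 := by
    intro q
    induction q with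
    | zero => rfl
    | succ q ih =>
      have := congrFun hdiff q
      rw [Function.iterate_succ_apply', fwdDiff, Pi.zero_apply] at this
      rw [← ih]
      linarith
  generalize I ⊔ Ideal.span (Set.range lin) = T at *
  have hTc : ∀ q, d ≤ q → hz T q = (fwdDiff 1)^[d] (hz I) 0 := by
    intro q hq
    obtain ⟨r, rfl⟩ := Nat.exists_eq_add_of_le' hq
    rw [key, hconst]
  constructor
  · set A : Set ℤ := {i : ℤ | ∃ P : Polynomial ℚ, ∀ q : ℤ, i ≤ q → P.eval (q : ℚ) = (HFZ K T q : ℚ)}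
      with hA
    have hmem : (d : ℤ) ∈ A := by
      refine ⟨Polynomial.C (((fwdDiff 1)^[d] (hz I) 0 : ℤ) : ℚ), fun q hq => ?_⟩
      obtain ⟨r, rfl⟩ := Int.eq_ofNat_of_zero_le (le_trans (by positivity) hq)
      have h1 := hTc r (by exact_mod_cast hq)
      rw [← h1]
      simp [HFZ, hz]
    change sInf A ≤ d
    by_cases hb : BddBelow A
    · exact csInf_le hb hmem
    · rw [Int.csInf_of_not_bddBelow hb]
      positivity
  · rintro k ⟨P, ⟨N, hN⟩, hdeg, hlead⟩ q hq
    have h1 := hTc q hq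
    have h2 := poly_diff (g := hz I) (N := N) (m := d) (k := k) (P := P)
      (fun q hq => by rw [hN q hq]; simp [hz]) hdeg hlead
    rw [← hconst N, h2] at h1
    unfold hz at h1
    exact_mod_cast h1

end Final

/-- Theorem 1.3 / Theorem 6.2(i).  Let `𝕃 ⊂ ℙ^n` be a linear space of
dimension `n-d` (cut out by `d` independent linear forms) such that `K̄[ℛ_L]/I(𝕃)` has Krull
dimension `1`.  Then `HReg(K[ℛ_L]/I(𝕃)) ≤ d`, and the Hilbert function of `K[ℛ_L]/I(𝕃)`
equals `deg ℛ_L` in all degrees `q ≥ d`. -/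
theorem hilbert_function_of_linear_section
    {d n : ℕ} (K : Type) [Field K] [CharZero K]
    (L : Matrix (Fin (d+1)) (Fin (n+1)) K) (hrank : L.rank = d + 1)
    (lin : Fin d → MvPolynomial (Fin (n+1)) K)
    (hhom : ∀ j, lin j ∈ MvPolynomial.homogeneousSubmodule (Fin (n+1)) K 1)
    (hindep : LinearIndependent K lin)
    (hdim : ringKrullDim (MvPolynomial (Fin (n+1)) (AlgebraicClosure K) ⧸
        Ideal.map (MvPolynomial.map (algebraMap K (AlgebraicClosure K)))
          (vanishingIdeal K (coneImageK K L) ⊔ Ideal.span (Set.range lin))) = 1) :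
    HReg K (vanishingIdeal K (coneImageK K L) ⊔ Ideal.span (Set.range lin)) ≤ d ∧
    ∀ k : ℕ, IsProjDegree K (vanishingIdeal K (coneImageK K L)) d k →
      ∀ q : ℕ, d ≤ q →
        hilb K (vanishingIdeal K (coneImageK K L) ⊔ Ideal.span (Set.range lin)) q = k := by
  exact final_aux K L hrank lin hhom hindep hdim

end ScatteringPaper
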